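/- arXiv:math/0508236 — 6 statements merged into one kernel-verified Lean document; each statement's English description precedes it below -/
import Mathlib

section
/- Let R → S be a local homomorphism of Noetherian local rings and assume that every scalar extension of R is an integral domain (R is universally irreducible). If the homomorphism is unramified, i.e., m_R·S = m_S, and dim R = dim S (equal Krull dimensions), then R → S is faithfully flat, and hence a scalar extension. -/
open IsLocalRing

universe u v

/-- A local homomorphism `f : R → S` between local rings is a *scalar extension* if `S` is
faithfully flat as an `R`-module (via `f`) and `f` is unramified, i.e. the maximal ideal of `S`
is the extension of the maximal ideal of `R`. -/
def IsScalarExtension {R S : Type*} [CommRing R] [CommRing S] [IsLocalRing R] [IsLocalRing S]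
    (f : R →+* S) : Prop :=
  (letI : Algebra R S := f.toAlgebra; Module.FaithfullyFlat R S) ∧
    (maximalIdeal R).map f = maximalIdeal S

section Complete

open MvPolynomial in
theorem MvPolynomial.homogeneousComponent_mul_of_isHomogeneous_right {σ k : Type*} [CommRing k]
    (P Q : MvPolynomial σ k) {d : ℕ} (hQ : Q.IsHomogeneous d) (n : ℕ) :
    homogeneousComponent n (P * Q) =
      if d ≤ n then homogeneousComponent (n - d) P * Q else 0 := by
  let := MvPolynomial.gradedAlgebra (σ := σ) (R := k)
  have key (R : MvPolynomial σ k) (m : ℕ) : homogeneousComponent m R =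
      (DirectSum.decompose (homogeneousSubmodule σ k) R m : MvPolynomial σ k) := by
    exact (MvPolynomial.decomposition.decompose'_apply R m).symm
  rw [key, key]
  split_ifs with h
  · exact DirectSum.coe_decompose_mul_of_right_mem_of_le (homogeneousSubmodule σ k) hQ h
  · exact DirectSum.coe_decompose_mul_of_right_mem_of_not_le (homogeneousSubmodule σ k) hQ h

open MvPolynomial in
theorem MvPolynomial.exists_isHomogeneous_map_eq {σ T k : Type*} [CommRing T] [CommRing k]
    {g : T →+* k} (hg : Function.Surjective g) {n : ℕ} {P : MvPolynomial σ k}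
    (hP : P.IsHomogeneous n) :
    ∃ Q : MvPolynomial σ T, Q.IsHomogeneous n ∧ map g Q = P := by
  obtain ⟨Q, rfl⟩ := map_surjective g hg P
  refine ⟨homogeneousComponent n Q, homogeneousComponent_isHomogeneous _ _, ?_⟩
  rw [← homogeneousComponent_eq_self hP]
  ext m
  simp only [coeff_map, coeff_homogeneousComponent]
  split_ifs <;> simp

open MvPolynomial in
theorem MvPolynomial.IsHomogeneous.eval_mem_mul_pow {σ T : Type*} [CommRing T]
    {P : MvPolynomial σ T} {n : ℕ} (hP : P.IsHomogeneous n) {I K : Ideal T}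
    (hK : ∀ m, P.coeff m ∈ K) {a : σ → T} (ha : ∀ i, a i ∈ I) :
    eval a P ∈ K * I ^ n := by
  rw [eval_eq]
  refine Ideal.sum_mem _ fun m hm ↦ Ideal.mul_mem_mul (hK m) ?_
  have h1 : m.degree = n := by
    rw [Finsupp.degree_eq_weight_one]; exact hP (mem_support_iff.mp hm)
  rw [← h1, Finsupp.degree_apply, ← Finset.prod_pow_eq_pow_sum]
  exact Ideal.prod_mem_prod fun i _ ↦ Ideal.pow_mem_pow (ha i) _

open MvPolynomial in
/-- A ring that is complete with respect to a finitely generated ideal `I` is Noetherian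
as soon as its quotient by `I` is. -/
theorem IsAdicComplete.isNoetherianRing {T : Type*} [CommRing T] (I : Ideal T) (hI : I.FG)
    [IsAdicComplete I T] [IsNoetherianRing (T ⧸ I)] : IsNoetherianRing T := by
  classical
  obtain ⟨s, hs⟩ := hI
  let a : s → T := fun i ↦ i
  have haI : Ideal.span (Set.range a) = I := by
    rw [← hs]; congr 1; ext; simp [a]
  have ha (i) : a i ∈ I := haI ▸ Ideal.subset_span ⟨i, rfl⟩
  refine ⟨fun J ↦ ?_⟩
  let H : Set (MvPolynomial s (T ⧸ I)) := {P | ∃ (d : ℕ) (F : MvPolynomial s T),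
    F.IsHomogeneous d ∧ map (Ideal.Quotient.mk I) F = P ∧ ∃ f ∈ J, f - eval a F ∈ I ^ (d + 1)}
  obtain ⟨H', hH', hspan⟩ := (Submodule.fg_span_iff_fg_span_finset_subset H).mp
    (IsNoetherian.noetherian (Ideal.span H))
  choose d F hF hFP f hfJ hfF using fun P : H' ↦ hH' P.2
  have step (n : ℕ) (x : T) (hxJ : x ∈ J) (hx : x ∈ I ^ n) :
      ∃ c : H' → T, (∀ i, c i ∈ I ^ (n - d i)) ∧ x - ∑ i, c i * f i ∈ I ^ (n + 1) := by
    rw [← haI, Ideal.mem_span_pow_iff_exists_isHomogeneous] at hx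
    obtain ⟨X, hX, rfl⟩ := hx
    have hmem : map (Ideal.Quotient.mk I) X ∈ Ideal.span H :=
      Ideal.subset_span ⟨n, X, hX, rfl, eval a X, hxJ, by simp⟩
    change _ ∈ Submodule.span _ H at hmem
    rw [hspan, Submodule.mem_span_finset'] at hmem
    obtain ⟨g, hg⟩ := hmem
    have hlift (i : H') : ∃ G : MvPolynomial s T, G.IsHomogeneous (n - d i) ∧
        map (Ideal.Quotient.mk I) G = if d i ≤ n then homogeneousComponent (n - d i) (g i) else 0 :=
      exists_isHomogeneous_map_eq Ideal.Quotient.mk_surjective (by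
        split_ifs
        · exact homogeneousComponent_isHomogeneous _ _
        · exact isHomogeneous_zero _ _ _)
    choose G hG hGm using hlift
    let G' : H' → MvPolynomial s T := fun i ↦ if d i ≤ n then G i else 0
    have hG' (i) : (G' i).IsHomogeneous (n - d i) := by
      simp only [G']; split_ifs
      · exact hG i
      · exact isHomogeneous_zero _ _ _
    have hGF (i) : (G' i * F i).IsHomogeneous n := by
      simp only [G']; split_ifs with h
      · have := (hG i).mul (hF i)
        rwa [Nat.sub_add_cancel h] at this
      · rw [zero_mul]; exact isHomogeneous_zero _ _ _
    have hD : (X - ∑ i, G' i * F i).IsHomogeneous n :=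
      hX.sub (IsHomogeneous.sum _ _ _ fun i _ ↦ hGF i)
    have hDI : map (Ideal.Quotient.mk I) (X - ∑ i, G' i * F i) = 0 := by
      rw [map_sub, map_sum, sub_eq_zero, ← homogeneousComponent_eq_self (hX.map _), ← hg, map_sum]
      refine Finset.sum_congr rfl fun i _ ↦ ?_
      rw [smul_eq_mul, homogeneousComponent_mul_of_isHomogeneous_right _ _
        (hFP i ▸ (hF i).map _) n, map_mul, hFP]
      simp only [G']
      split_ifs with h
      · rw [hGm, if_pos h]
      · simp
    have hDmem : eval a (X - ∑ i, G' i * F i) ∈ I ^ (n + 1) := by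
      rw [pow_succ']
      refine hD.eval_mem_mul_pow (fun m ↦ ?_) ha
      rw [← Ideal.Quotient.eq_zero_iff_mem, ← coeff_map, hDI, coeff_zero]
    have hGmem (i) : eval a (G' i) ∈ I ^ (n - d i) := by
      have := (hG' i).eval_mem_mul_pow (K := ⊤) (fun _ ↦ trivial) ha
      rwa [Ideal.top_mul] at this
    refine ⟨fun i ↦ eval a (G' i), hGmem, ?_⟩
    have : eval a X - ∑ i, eval a (G' i) * f i = eval a (X - ∑ i, G' i * F i) -
        ∑ i, eval a (G' i) * (f i - eval a (F i)) := by
      simp only [map_sub, map_sum, map_mul, mul_sub, Finset.sum_sub_distrib]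
      ring
    rw [this]
    refine Ideal.sub_mem _ hDmem (Ideal.sum_mem _ fun i _ ↦ ?_)
    by_cases h : d i ≤ n
    · have := Ideal.mul_mem_mul (hGmem i) (hfF i)
      rwa [← pow_add, ← add_assoc, Nat.sub_add_cancel h] at this
    · simp [G', h]
  refine ⟨Finset.univ.image f, le_antisymm (Ideal.span_le.mpr ?_) fun x hx ↦ ?_⟩
  · intro y hy
    simp only [Finset.coe_image, Finset.coe_univ, Set.image_univ] at hy
    obtain ⟨i, rfl⟩ := hy
    exact hfJ i
  choose c hc hcx using step
  let r : ∀ n, {y : T // y ∈ J ∧ y ∈ I ^ n} := fun n ↦ Nat.rec ⟨x, hx, by simp⟩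
    (fun n y ↦ ⟨y.1 - ∑ i, c n y.1 y.2.1 y.2.2 i * f i,
      J.sub_mem y.2.1 (J.sum_mem fun i _ ↦ Ideal.mul_mem_left J _ (hfJ i)), hcx _ _ _ _⟩) n
  let e : ℕ → H' → T := fun n ↦ c n (r n).1 (r n).2.1 (r n).2.2
  have hr0 : (r 0).1 = x := rfl
  have hrs (n) : (r (n + 1)).1 = (r n).1 - ∑ i, e n i * f i := rfl
  let D := ∑ i, d i
  have hdD (i) : d i ≤ D := Finset.single_le_sum (fun _ _ ↦ Nat.zero_le _) (Finset.mem_univ i)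
  let E : ℕ → H' → T := fun n i ↦ ∑ k ∈ Finset.range (n + D), e k i
  have hE (m n : ℕ) (hmn : m ≤ n) (i : H') : E m i ≡ E n i [SMOD (I ^ m • ⊤ : Submodule T T)] := by
    rw [SModEq.comm, SModEq.sub_mem, smul_eq_mul, Ideal.mul_top]
    induction n, hmn using Nat.le_induction with
    | base => simp
    | succ n hmn ih =>
      have : E (n + 1) i - E m i = E n i - E m i + e (n + D) i := by
        simp only [E, show n + 1 + D = n + D + 1 by ring, Finset.sum_range_succ]; ring
      rw [this]
      exact Ideal.add_mem _ ih (Ideal.pow_le_pow_right (by have := hdD i; omega)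
        (hc (n + D) _ _ _ i))
  choose l hl using fun i : H' ↦ IsPrecomplete.prec' (I := I) (fun n ↦ E n i)
    (fun {m n} h ↦ hE m n h i)
  have hrE (N : ℕ) : x - ∑ i, (∑ k ∈ Finset.range N, e k i) * f i = (r N).1 := by
    induction N with
    | zero => simp [hr0]
    | succ N ih =>
      rw [hrs, ← ih]
      simp only [Finset.sum_range_succ, add_mul, Finset.sum_add_distrib]
      ring
  have hx0 : x - ∑ i, l i * f i = 0 := by
    refine IsHausdorff.haus' (I := I) _ fun n ↦ ?_
    rw [SModEq.zero, smul_eq_mul, Ideal.mul_top]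
    have h1 : x - ∑ i, l i * f i = (r (n + D)).1 + ∑ i, (E n i - l i) * f i := by
      rw [← hrE]
      simp only [E, sub_mul, Finset.sum_sub_distrib]
      ring
    rw [h1]
    refine Ideal.add_mem _ (Ideal.pow_le_pow_right (Nat.le_add_right n D) (r (n + D)).2.2)
      (Ideal.sum_mem _ fun i _ ↦ Ideal.mul_mem_right _ _ ?_)
    have := hl i n
    rwa [SModEq.sub_mem, smul_eq_mul, Ideal.mul_top] at this
  rw [sub_eq_zero.mp hx0]
  exact Ideal.sum_mem _ fun i _ ↦ Ideal.mul_mem_left _ _ (Ideal.subset_span (by simp))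

end Complete

section Flat

/-- In a flat algebra, a linear relation modulo an ideal of the base ring is a combination of
relations modulo this ideal in the base ring. -/
theorem Module.Flat.exists_eq_sum_of_sum_smul_mem_map {R A : Type*} [CommRing R] [CommRing A]
    [Algebra R A] [Module.Flat R A] (I : Ideal R) {n : ℕ} (r : Fin n → R) (a : Fin n → A)
    (h : ∑ i, r i • a i ∈ I.map (algebraMap R A)) :
    ∃ (k : ℕ) (ρ : Fin n → Fin k → R) (y : Fin k → A),
      (∀ j, ∑ i, r i * ρ i j ∈ I) ∧ ∀ i, a i = ∑ j, ρ i j • y j := by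
  obtain ⟨l, b, s, hs⟩ := Submodule.mem_span_set'.mp h
  choose c hcI hc using fun i ↦ (s i).2
  have h0 : ∑ i, Sum.elim r (fun i ↦ - c i) i • Sum.elim a b i = 0 := by
    simp only [Fintype.sum_sum_type, Sum.elim_inl, Sum.elim_inr, neg_smul, Finset.sum_neg_distrib,
      ← sub_eq_add_neg, sub_eq_zero]
    rw [← hs]
    refine Finset.sum_congr rfl fun i _ ↦ ?_
    rw [← hc, smul_eq_mul, Algebra.smul_def, mul_comm]
  obtain ⟨k, ρ, y, hy, hρ⟩ := Module.Flat.isTrivialRelation_of_sum_smul_eq_zero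
    (f := Sum.elim r (fun i ↦ - c i)) (x := Sum.elim a b) h0
  refine ⟨k, fun i j ↦ ρ (.inl i) j, y, fun j ↦ ?_, fun i ↦ hy (.inl i)⟩
  have := hρ j
  simp only [Fintype.sum_sum_type, Sum.elim_inl, Sum.elim_inr, neg_mul, Finset.sum_neg_distrib,
      ← sub_eq_add_neg, sub_eq_zero] at this
  rw [this]
  exact I.sum_mem fun i _ ↦ I.mul_mem_right _ (hcI i)

theorem Ideal.exists_eq_sum_smul_of_mem_map_span_range_mul {R A : Type*} [CommRing R] [CommRing A]
    [Algebra R A] {n : ℕ} (r : Fin n → R) (J : Ideal A) {x : A}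
    (hx : x ∈ (Ideal.span (Set.range r)).map (algebraMap R A) * J) :
    ∃ j : Fin n → A, (∀ i, j i ∈ J) ∧ x = ∑ i, r i • j i := by
  induction hx using Submodule.mul_induction_on' with
  | mem_mul_mem a ha b hb =>
    rw [Ideal.map_span, ← Set.range_comp, Ideal.mem_span_range_iff_exists_fun] at ha
    obtain ⟨c, rfl⟩ := ha
    refine ⟨fun i ↦ c i * b, fun i ↦ J.mul_mem_left _ hb, ?_⟩
    rw [Finset.sum_mul]
    refine Finset.sum_congr rfl fun i _ ↦ ?_
    rw [Algebra.smul_def, Function.comp_apply]; ring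
  | add a _ b _ ha hb =>
    obtain ⟨j, hj, rfl⟩ := ha
    obtain ⟨j', hj', rfl⟩ := hb
    exact ⟨j + j', fun i ↦ J.add_mem (hj i) (hj' i), by simp [Finset.sum_add_distrib]⟩

variable {R : Type*} [CommRing R] [IsLocalRing R] [IsNoetherianRing R]

/-- If `A` is flat over the local ring `R` and `J ∩ 𝔪A = 𝔪J`, then `J ∩ IA = IJ` for
every `𝔪`-primary ideal `I`. -/
theorem Ideal.inf_map_le_map_mul_of_inf_map_maximalIdeal_le {A : Type*} [CommRing A] [Algebra R A]
    [Module.Flat R A] {J : Ideal A}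
    (hJ : J ⊓ (maximalIdeal R).map (algebraMap R A) ≤ (maximalIdeal R).map (algebraMap R A) * J)
    (I : Ideal R) {N : ℕ} (hN : maximalIdeal R ^ N ≤ I) :
    J ⊓ I.map (algebraMap R A) ≤ I.map (algebraMap R A) * J := by
  classical
  induction I using WellFoundedGT.induction with
  | ind I ih =>
  by_cases hI : I = ⊤
  · simp [hI, Ideal.map_top]
  have hNI : ∃ N, maximalIdeal R ^ N ≤ I := ⟨N, hN⟩
  have hpos : Nat.find hNI ≠ 0 := fun h0 ↦ hI <| by
    have := Nat.find_spec hNI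
    rwa [h0, pow_zero, Ideal.one_eq_top, top_le_iff] at this
  obtain ⟨x, hx, hxI⟩ := SetLike.not_le_iff_exists.mp
    (Nat.find_min hNI (Nat.sub_one_lt hpos))
  have hmx (μ : R) (hμ : μ ∈ maximalIdeal R) : μ * x ∈ I := by
    refine Nat.find_spec hNI ?_
    rw [← Nat.sub_one_add_one hpos, pow_succ']
    exact Ideal.mul_mem_mul hμ hx
  have hlt : I < I ⊔ Ideal.span {x} := lt_of_le_of_ne le_sup_left fun h ↦ hxI <| by
    rw [h]; exact Ideal.mem_sup_right (Ideal.mem_span_singleton_self x)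
  rintro j ⟨hjJ, hjI⟩
  have h1 := ih _ hlt (hN.trans le_sup_left) ⟨hjJ, Ideal.map_mono le_sup_left hjI⟩
  rw [Ideal.map_sup, Ideal.sup_mul, Ideal.map_span, Set.image_singleton] at h1
  obtain ⟨p, hp, q, hq, rfl⟩ := Submodule.mem_sup.mp h1
  obtain ⟨b, hb, rfl⟩ := Ideal.mem_span_singleton_mul.mp hq
  have hqI : algebraMap R A x * b ∈ I.map (algebraMap R A) :=
    (Ideal.add_mem_iff_right _ (Ideal.mul_le_left hp)).mp hjI
  obtain ⟨k, ρ, y, hρ, hy⟩ := Module.Flat.exists_eq_sum_of_sum_smul_mem_map I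
    (n := 1) (fun _ ↦ x) (fun _ ↦ b) (by simpa [Algebra.smul_def] using hqI)
  have hbm : b ∈ (maximalIdeal R).map (algebraMap R A) := by
    rw [hy 0]
    refine Ideal.sum_mem _ fun j _ ↦ ?_
    rw [Algebra.smul_def]
    refine Ideal.mul_mem_right _ _ (Ideal.mem_map_of_mem _ ?_)
    rw [mem_maximalIdeal, mem_nonunits_iff]
    intro hu
    have := hρ j
    simp only [Finset.univ_unique, Finset.sum_singleton] at this
    exact hxI ((Ideal.mul_unit_mem_iff_mem I hu).mp this)
  refine Ideal.add_mem _ hp ?_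
  have hbmJ := hJ ⟨hb, hbm⟩
  have : algebraMap R A x * b ∈
      Ideal.span {algebraMap R A x} * ((maximalIdeal R).map (algebraMap R A) * J) :=
    Ideal.mul_mem_mul (Ideal.mem_span_singleton_self _) hbmJ
  rw [← mul_assoc] at this
  refine Ideal.mul_mono_left ?_ this
  rw [← Set.image_singleton, ← Ideal.map_span, ← Ideal.map_mul]
  refine Ideal.map_mono (Ideal.mul_le.mpr fun c hc μ hμ ↦ ?_)
  obtain ⟨d, rfl⟩ := Ideal.mem_span_singleton'.mp hc
  rw [mul_assoc, mul_comm x]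
  exact I.mul_mem_left _ (hmx μ hμ)

/-- A linear relation in an approximation `T` of `A ⧸ J` modulo an `𝔪`-primary ideal `I` comes
from relations modulo `I` in the base ring. -/
theorem Module.Flat.exists_sub_sum_smul_mem_map {A T : Type*} [CommRing A] [Algebra R A]
    [Module.Flat R A] [CommRing T] [Algebra R T] {J : Ideal A}
    (hJ : J ⊓ (maximalIdeal R).map (algebraMap R A) ≤ (maximalIdeal R).map (algebraMap R A) * J)
    (φ : A →ₐ[R] T) (hφJ : ∀ x ∈ J, φ x = 0) (I : Ideal R) {N : ℕ} (hN : maximalIdeal R ^ N ≤ I)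
    (hsurj : ∀ t, ∃ a, t - φ a ∈ I.map (algebraMap R T))
    (hker : ∀ a, φ a ∈ I.map (algebraMap R T) → a ∈ J ⊔ I.map (algebraMap R A))
    {n : ℕ} (r : Fin n → R) (t : Fin n → T) (h : ∑ i, r i • t i = 0) :
    ∃ (k : ℕ) (ρ : Fin n → Fin k → R) (y : Fin k → T),
      (∀ j, ∑ i, r i * ρ i j ∈ I) ∧
        ∀ i, t i - ∑ j, ρ i j • y j ∈ I.map (algebraMap R T) := by
  choose a ha using fun i ↦ hsurj (t i)
  have h1 : φ (∑ i, r i • a i) ∈ I.map (algebraMap R T) := by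
    have : φ (∑ i, r i • a i) = - ∑ i, r i • (t i - φ (a i)) := by
      simp [smul_sub, h]
    rw [this]
    refine neg_mem (Ideal.sum_mem _ fun i _ ↦ ?_)
    rw [Algebra.smul_def]
    exact Ideal.mul_mem_left _ _ (ha i)
  obtain ⟨j, hj, c, hc, hjc⟩ := Submodule.mem_sup.mp (hker _ h1)
  have hjr : j ∈ (I ⊔ Ideal.span (Set.range r)).map (algebraMap R A) := by
    rw [eq_sub_of_add_eq hjc]
    refine Ideal.sub_mem _ (Ideal.sum_mem _ fun i _ ↦ ?_) (Ideal.map_mono le_sup_left hc)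
    rw [Algebra.smul_def]
    exact Ideal.mul_mem_right _ _ (Ideal.mem_map_of_mem _
      (Ideal.mem_sup_right (Ideal.subset_span ⟨i, rfl⟩)))
  have h2 := Ideal.inf_map_le_map_mul_of_inf_map_maximalIdeal_le hJ _ (hN.trans le_sup_left)
    ⟨hj, hjr⟩
  rw [Ideal.map_sup, Ideal.sup_mul] at h2
  obtain ⟨j₁, hj₁, j₂, hj₂, hjj⟩ := Submodule.mem_sup.mp h2
  obtain ⟨e, he, hej⟩ := Ideal.exists_eq_sum_smul_of_mem_map_span_range_mul r J hj₂
  have h3 : ∑ i, r i • (a i - e i) ∈ I.map (algebraMap R A) := by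
    have : ∑ i, r i • (a i - e i) = j₁ + c := by
      rw [Finset.sum_congr rfl fun i _ ↦ smul_sub (r i) (a i) (e i), Finset.sum_sub_distrib,
        ← hej, ← hjc, ← hjj]
      ring
    rw [this]
    exact Ideal.add_mem _ (Ideal.mul_le_left (J := J) hj₁) hc
  obtain ⟨k, ρ, y, hρ, hy⟩ := Module.Flat.exists_eq_sum_of_sum_smul_mem_map I _ _ h3
  refine ⟨k, ρ, fun j ↦ φ (y j), hρ, fun i ↦ ?_⟩
  have : φ (a i) = ∑ j, ρ i j • φ (y j) := by
    rw [← sub_zero (φ (a i)), ← hφJ _ (he i), ← map_sub, hy, map_sum]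
    simp
  rw [← this]
  exact ha i

/-- A version of the local criterion of flatness for a quotient of a flat algebra, which is
only compared with `T` modulo powers of the maximal ideal. -/
theorem Module.Flat.of_inf_map_maximalIdeal_le {A T : Type*} [CommRing A] [Algebra R A]
    [Module.Flat R A] [CommRing T] [Algebra R T] [IsNoetherianRing T]
    (hT : (maximalIdeal R).map (algebraMap R T) ≤ Ideal.jacobson ⊥)
    {J : Ideal A}
    (hJ : J ⊓ (maximalIdeal R).map (algebraMap R A) ≤ (maximalIdeal R).map (algebraMap R A) * J)
    (φ : A →ₐ[R] T) (hφJ : ∀ x ∈ J, φ x = 0)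
    (hsurj : ∀ N t, ∃ a, t - φ a ∈ (maximalIdeal R ^ N).map (algebraMap R T))
    (hker : ∀ N a, φ a ∈ (maximalIdeal R ^ N).map (algebraMap R T) →
      a ∈ J ⊔ (maximalIdeal R ^ N).map (algebraMap R A)) :
    Module.Flat R T := by
  refine Module.Flat.of_forall_isTrivialRelation fun {n r t} h ↦ ?_
  let L : (Fin n → R) →ₗ[R] R := Fintype.linearCombination R r
  have hL (ρ) : L ρ = ∑ i, r i * ρ i := by
    simp [L, Fintype.linearCombination_apply, mul_comm]
  let ι : (Fin n → R) →ₗ[R] (Fin n → T) := (Algebra.linearMap R T).compLeft (Fin n)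
  have hι (ρ i) : ι ρ i = algebraMap R T (ρ i) := rfl
  let W : Submodule T (Fin n → T) := Submodule.span T (ι '' (LinearMap.ker L))
  have hsmul (k : ℕ) (v : Fin n → T)
      (hv : ∀ i, v i ∈ (maximalIdeal R ^ k).map (algebraMap R T)) :
      v ∈ ((maximalIdeal R).map (algebraMap R T)) ^ k • (⊤ : Submodule T (Fin n → T)) := by
    rw [pi_eq_sum_univ' v]
    refine Submodule.sum_mem _ fun i _ ↦ Submodule.smul_mem_smul ?_ trivial
    rw [← Ideal.map_pow]; exact hv i
  have htW : t ∈ W := by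
    rw [← Submodule.Quotient.mk_eq_zero]
    have := IsHausdorff.of_le_jacobson _ ((Fin n → T) ⧸ W) hT
    refine this.haus' _ fun k ↦ ?_
    rw [SModEq.zero]
    suffices t ∈ W ⊔ ((maximalIdeal R).map (algebraMap R T)) ^ k •
        (⊤ : Submodule T (Fin n → T)) by
      obtain ⟨w, hw, v, hv, rfl⟩ := Submodule.mem_sup.mp this
      rw [Submodule.Quotient.mk_add, (Submodule.Quotient.mk_eq_zero W).mpr hw, zero_add]
      have := Submodule.mem_map_of_mem (f := W.mkQ) hv
      rw [Submodule.map_smul''] at this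
      exact Submodule.smul_mono le_rfl le_top this
    obtain ⟨k₀, hk₀⟩ := Ideal.exists_pow_inf_eq_pow_smul (maximalIdeal R) (LinearMap.range L)
    obtain ⟨q, ρ, y, hρ, hy⟩ := Module.Flat.exists_sub_sum_smul_mem_map hJ φ hφJ _
      le_rfl (hsurj (k₀ + k)) (hker (k₀ + k)) r t h
    have h4 (j) : ∃ σ, σ ∈ LinearMap.ker L ∧ ∃ v : Fin n → R,
        (∀ i, v i ∈ maximalIdeal R ^ k) ∧ (fun i ↦ ρ i j) = σ + v := by
      have h5 : L (fun i ↦ ρ i j) ∈ maximalIdeal R ^ k • LinearMap.range L := by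
        have h6 : L (fun i ↦ ρ i j) ∈ maximalIdeal R ^ (k₀ + k) • (⊤ : Submodule R R) ⊓
            LinearMap.range L := ⟨by rw [smul_eq_mul, Ideal.mul_top, hL]; exact hρ j, ⟨_, rfl⟩⟩
        rw [hk₀ _ (Nat.le_add_right _ _), Nat.add_sub_cancel_left] at h6
        exact Submodule.smul_mono le_rfl inf_le_right h6
      rw [LinearMap.range_eq_map, ← Submodule.map_smul''] at h5
      obtain ⟨v, hv, hvL⟩ := h5
      refine ⟨(fun i ↦ ρ i j) - v, by rw [LinearMap.mem_ker, map_sub, hvL, sub_self], v,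
        fun i ↦ ?_, by simp⟩
      have := Submodule.mem_map_of_mem (f := LinearMap.proj (R := R) (φ := fun _ : Fin n ↦ R) i) hv
      rw [Submodule.map_smul''] at this
      have := Submodule.smul_mono le_rfl (le_top (a := Submodule.map _ _)) this
      rwa [smul_eq_mul, Ideal.mul_top] at this
    choose σ hσ v hv hσv using h4
    have ht : t = ∑ j, y j • ι (σ j) + ((∑ j, y j • ι (v j)) +
        fun i ↦ t i - ∑ j, ρ i j • y j) := by
      funext i
      have hρi (j) : ρ i j = σ j i + v j i := congr_fun (hσv j) i
      have hs : ∑ j, ρ i j • y j = ∑ j, y j * ι (σ j) i + ∑ j, y j * ι (v j) i := by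
        rw [← Finset.sum_add_distrib]
        refine Finset.sum_congr rfl fun j _ ↦ ?_
        rw [hι, hι, hρi, Algebra.smul_def, map_add]
        ring
      simp only [Pi.add_apply, Finset.sum_apply, Pi.smul_apply, smul_eq_mul, hs]
      ring
    rw [ht]
    refine Submodule.add_mem_sup (Submodule.sum_mem _ fun j _ ↦ Submodule.smul_mem _ _
      (Submodule.subset_span ⟨_, hσ j, rfl⟩)) (hsmul _ _ fun i ↦ ?_)
    rw [Pi.add_apply, Finset.sum_apply]
    refine Ideal.add_mem _ (Ideal.sum_mem _ fun j _ ↦ ?_)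
      (Ideal.map_mono (Ideal.pow_le_pow_right (Nat.le_add_left _ _)) (hy i))
    exact Ideal.mul_mem_left _ _ (Ideal.mem_map_of_mem _ (hv j i))
  obtain ⟨k, y, w, hw⟩ := Submodule.mem_span_set'.mp htW
  choose σ hσ hσw using fun j ↦ (w j).2
  refine ⟨k, fun i j ↦ σ j i, y, fun i ↦ ?_, fun j ↦ ?_⟩
  · rw [← hw, Finset.sum_apply]
    refine Finset.sum_congr rfl fun j _ ↦ ?_
    rw [Pi.smul_apply, ← hσw, hι, smul_eq_mul, mul_comm, ← Algebra.smul_def]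
  · rw [← hL]; exact hσ j

end Flat

section FieldGenerators

open MvPolynomial

namespace MvPolynomial

/-- The kernel of the evaluation of one variable at an algebraic element is generated by its
minimal polynomial. -/
theorem mem_span_aeval_minpoly_of_aeval_eq_zero {ι E L : Type*} [DecidableEq ι] [Field E] [Field L]
    [Algebra E L] (t : ι) {a : L} (ha : IsIntegral E a) {f : MvPolynomial ι E}
    (hf : aeval (fun u ↦ if u = t then C a else (X u : MvPolynomial ι L)) f = 0) :
    f ∈ Ideal.span {Polynomial.aeval (X t : MvPolynomial ι E) (minpoly E a)} := by
  set p := minpoly E a with hp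
  set M := Ideal.span {Polynomial.aeval (X t : MvPolynomial ι E) p}
  have : Fact (Irreducible p) := ⟨minpoly.irreducible ha⟩
  let θ : AdjoinRoot p →ₐ[E] L := AdjoinRoot.liftAlgHom p (Algebra.ofId E L) a (minpoly.aeval E a)
  have hθ : θ (AdjoinRoot.root p) = a := AdjoinRoot.liftAlgHom_root ..
  let ψ : MvPolynomial ι E →ₐ[E] MvPolynomial ι (AdjoinRoot p) :=
    aeval (fun u ↦ if u = t then C (AdjoinRoot.root p) else X u)
  have h1 : mapAlgHom θ (ψ f) = 0 := by
    rw [← hf, ← AlgHom.comp_apply]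
    congr 1
    ext u : 1
    by_cases hu : u = t <;> simp [ψ, hu, hθ]
  have h2 : ψ f = 0 := by
    refine map_injective (θ : AdjoinRoot p →+* L) (RingHom.injective _) ?_
    rw [map_zero]; exact h1
  have hroot : Polynomial.aeval (Ideal.Quotient.mk M (X t)) p = 0 := by
    rw [← Ideal.Quotient.mkₐ_eq_mk E, Polynomial.aeval_algHom_apply, Ideal.Quotient.mkₐ_eq_mk,
      Ideal.Quotient.eq_zero_iff_mem]
    exact Ideal.mem_span_singleton_self _
  let χ₀ : AdjoinRoot p →ₐ[E] MvPolynomial ι E ⧸ M :=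
    AdjoinRoot.liftAlgHom p (Algebra.ofId E _) (Ideal.Quotient.mk M (X t)) hroot
  have hχ₀ : χ₀ (AdjoinRoot.root p) = Ideal.Quotient.mk M (X t) := AdjoinRoot.liftAlgHom_root ..
  let χ : MvPolynomial ι (AdjoinRoot p) →+* MvPolynomial ι E ⧸ M :=
    eval₂Hom (χ₀ : AdjoinRoot p →+* _) (fun u ↦ Ideal.Quotient.mk M (X u))
  have h3 : χ.comp (ψ : MvPolynomial ι E →+* _) = Ideal.Quotient.mk M := by
    refine ringHom_ext (fun e ↦ ?_) fun u ↦ ?_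
    · have : ψ (C e) = C (algebraMap E _ e) := by
        rw [← algebraMap_eq, AlgHom.commutes]; rfl
      simp only [RingHom.comp_apply, RingHom.coe_coe, this, χ, coe_eval₂Hom, eval₂_C]
      rw [AlgHom.commutes]; rfl
    · by_cases hu : u = t <;> simp [ψ, χ, hu, hχ₀]
  rw [← Ideal.Quotient.eq_zero_iff_mem, ← h3, RingHom.comp_apply, RingHom.coe_coe, h2, map_zero]

section

variable {ι K L : Type*} [Field K] [Field L] [Algebra K L]

open scoped Classical in
/-- Evaluate the variables belonging to `D`, keeping the other variables. -/
noncomputable def evalOn (α : ι → L) (D : Set ι) : MvPolynomial ι K →ₐ[K] MvPolynomial ι L :=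
  aeval fun u ↦ if u ∈ D then C (α u) else X u

theorem evalOn_eq_zero_of_subset (α : ι → L) {D D' : Set ι} (hD : D ⊆ D') {f : MvPolynomial ι K}
    (hf : evalOn α D f = 0) : evalOn α D' f = 0 := by
  classical
  let ρ : MvPolynomial ι L →ₐ[L] MvPolynomial ι L := aeval fun u ↦ if u ∈ D' then C (α u) else X u
  have : evalOn (K := K) α D' = (ρ.restrictScalars K).comp (evalOn α D) := by
    ext u : 1
    by_cases hu : u ∈ D
    · simp [evalOn, hu, hD hu, ← algebraMap_eq]
    · simp [evalOn, hu, ρ]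
  rw [this, AlgHom.comp_apply, hf, map_zero]

theorem exists_evalOn_insert_generator [Algebra.IsAlgebraic K L] (α : ι → L) {D : Set ι} {t : ι}
    (ht : t ∉ D) :
    ∃ y : MvPolynomial ι K, evalOn α (insert t D) y = 0 ∧ evalOn α D y ≠ 0 ∧
      ∀ f, evalOn α (insert t D) f = 0 → ∃ g, evalOn α D (f - y * g) = 0 := by
  classical
  let E := IntermediateField.adjoin K (α '' D)
  have hE (e : E) : ∃ f : MvPolynomial ι K, evalOn α D f = C (e : L) := by
    have he : (e : L) ∈ E.toSubalgebra := e.2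
    rw [IntermediateField.adjoin_toSubalgebra_of_isAlgebraic
      fun x _ ↦ Algebra.IsAlgebraic.isAlgebraic x, Set.image_eq_range,
      Algebra.adjoin_range_eq_range_aeval] at he
    obtain ⟨q, hq⟩ := he
    refine ⟨rename Subtype.val q, ?_⟩
    rw [← hq, ← AlgHom.comp_apply]
    change _ = ((Algebra.algHom K L (MvPolynomial ι L)).comp
      (aeval fun u : D ↦ α u : MvPolynomial D K →ₐ[K] L)) q
    congr 1
    ext u : 1
    simp [evalOn]
    rfl
  let αE : D → E := fun u ↦ ⟨α u, IntermediateField.subset_adjoin _ _ ⟨u, u.2, rfl⟩⟩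
  let σ : MvPolynomial ι K →ₐ[K] MvPolynomial ι E :=
    aeval fun u ↦ if hu : u ∈ D then C (αE ⟨u, hu⟩) else X u
  let τ : MvPolynomial ι E →ₐ[E] MvPolynomial ι E :=
    aeval fun u ↦ if hu : u ∈ D then C (αE ⟨u, hu⟩) else X u
  have hinj : Function.Injective (mapAlgHom (σ := ι) (E.val)) :=
    map_injective _ (RingHom.injective _)
  have hσ (f : MvPolynomial ι K) : mapAlgHom E.val (σ f) = evalOn α D f := by
    rw [← AlgHom.comp_apply]
    congr 1
    ext u : 1
    by_cases hu : u ∈ D <;> simp [σ, evalOn, hu, αE]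
  have hτσ (f : MvPolynomial ι K) : τ (σ f) = σ f := by
    change ((τ.restrictScalars K).comp σ) f = σ f
    congr 1
    ext u : 1
    by_cases hu : u ∈ D
    · simp [σ, hu, ← algebraMap_eq]
    · simp [σ, hu, τ]
  have hτ (g : MvPolynomial ι E) : ∃ f, σ f = τ g := by
    induction g using MvPolynomial.induction_on with
    | C e =>
      obtain ⟨f, hf⟩ := hE e
      refine ⟨f, hinj ?_⟩
      rw [hσ, hf, ← algebraMap_eq (R := E), AlgHom.commutes, algebraMap_eq]
      simp
    | add p q hp hq =>
      obtain ⟨f, hf⟩ := hp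
      obtain ⟨g, hg⟩ := hq
      exact ⟨f + g, by rw [map_add, hf, hg, map_add]⟩
    | mul_X p u hp =>
      obtain ⟨f, hf⟩ := hp
      exact ⟨f * X u, by rw [map_mul, hf, map_mul]; congr 1; simp [σ, τ]⟩
  let θ : MvPolynomial ι E →ₐ[E] MvPolynomial ι L :=
    aeval fun u ↦ if u = t then C (α t) else X u
  have hθ (f : MvPolynomial ι K) : θ (σ f) = evalOn α (insert t D) f := by
    change ((θ.restrictScalars K).comp σ) f = _
    congr 1
    ext u : 1
    by_cases hu : u ∈ D
    · simp [σ, evalOn, hu, ← algebraMap_eq, αE]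
    · by_cases hut : u = t <;> simp [σ, evalOn, hu, hut, θ, ht]
  have hα : IsIntegral E (α t) := (Algebra.IsAlgebraic.isAlgebraic (R := E) (α t)).isIntegral
  set P : MvPolynomial ι E := Polynomial.aeval (X t : MvPolynomial ι E) (minpoly E (α t)) with hP
  have hτP : τ P = P := by
    rw [hP, ← Polynomial.aeval_algHom_apply]
    simp [τ, ht]
  obtain ⟨y, hy⟩ := hτ P
  rw [hτP] at hy
  refine ⟨y, ?_, ?_, fun f hf ↦ ?_⟩
  · rw [← hθ, hy, hP, ← Polynomial.aeval_algHom_apply]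
    have : θ (X t) = algebraMap L _ (α t) := by simp [θ, algebraMap_eq]
    rw [this, Polynomial.aeval_algebraMap_apply, minpoly.aeval, map_zero]
  · rw [← hσ, hy, ne_eq, ← map_zero (mapAlgHom (σ := ι) E.val), hinj.eq_iff, hP]
    have := (transcendental_X E t)
    exact (transcendental_iff.mp this _).mt (minpoly.ne_zero hα)
  · rw [← hθ] at hf
    obtain ⟨g, hg⟩ := Ideal.mem_span_singleton'.mp (mem_span_aeval_minpoly_of_aeval_eq_zero t hα hf)
    obtain ⟨g', hg'⟩ := hτ g
    refine ⟨g', ?_⟩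
    have : σ f = σ (y * g') := by
      rw [← hτσ, ← hg, map_mul, ← hP, hτP, map_mul, hy, hg', mul_comm]
    rw [← hσ, map_sub, this, sub_self, map_zero]

variable [LinearOrder ι]

theorem mem_span_image_of_evalOn_eq_zero (α : ι → L) (y : ι → MvPolynomial ι K) {D : Set ι}
    (hD : IsLowerSet D)
    (h : ∀ s ∈ D, ∀ f, evalOn α (Set.Iic s) f = 0 → f ∈ Ideal.span (y '' Set.Iic s))
    {f : MvPolynomial ι K} (hf : evalOn α D f = 0) : f ∈ Ideal.span (y '' D) := by
  classical
  rcases (f.vars.filter (· ∈ D)).eq_empty_or_nonempty with hV | hV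
  · have hinj : Function.Injective (map (σ := ι) (algebraMap K L)) :=
      map_injective _ (RingHom.injective _)
    have : map (algebraMap K L) f = evalOn α D f := by
      refine hom_congr_vars (f₂ := (evalOn (K := K) α D).toRingHom) ?_
        (fun u hu _ ↦ ?_) rfl
      · exact RingHom.ext fun c ↦ (map_C _ c).trans ((evalOn α D).commutes c).symm
      · have : u ∉ D := fun huD ↦ by simpa [hV] using Finset.mem_filter.mpr ⟨hu, huD⟩
        simp [evalOn, this]
    have : f = 0 := hinj (by rw [this, hf, map_zero])
    simp [this]
  · set s := (f.vars.filter (· ∈ D)).max' hV with hs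
    have hsD : s ∈ D := (Finset.mem_filter.mp (Finset.max'_mem _ hV)).2
    refine Ideal.span_mono (Set.image_mono (hD.Iic_subset hsD)) (h s hsD f ?_)
    rw [← hf]
    refine hom_congr_vars (f₁ := (evalOn (K := K) α _).toRingHom)
      (f₂ := (evalOn (K := K) α _).toRingHom) ?_ (fun u hu _ ↦ ?_) rfl
    · ext1
      simp [← algebraMap_eq]
    · have : u ∈ Set.Iic s ↔ u ∈ D := ⟨fun hus ↦ hD hus hsD,
        fun huD ↦ Finset.le_max' _ _ (Finset.mem_filter.mpr ⟨hu, huD⟩)⟩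
      change evalOn α _ (X u) = evalOn α _ (X u)
      simp only [evalOn, aeval_X, this]

theorem exists_generators_ker_aeval [WellFoundedLT ι] [Algebra.IsAlgebraic K L] (α : ι → L) :
    ∃ y : ι → MvPolynomial ι K, RingHom.ker (aeval (R := K) α) = Ideal.span (Set.range y) ∧
      ∀ t c, c * y t ∈ Ideal.span (y '' Set.Iio t) → c ∈ Ideal.span (y '' Set.Iio t) := by
  choose y hy0 hy1 hy using fun t ↦ exists_evalOn_insert_generator (K := K) α
    (Set.self_notMem_Iio (a := t))
  simp only [Set.Iio_insert] at hy0 hy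
  have hIic (t : ι) : ∀ f, evalOn α (Set.Iic t) f = 0 → f ∈ Ideal.span (y '' Set.Iic t) := by
    induction t using WellFoundedLT.induction with
    | ind t ih =>
    intro f hf
    obtain ⟨g, hg⟩ := hy t f hf
    rw [← sub_add_cancel f (y t * g)]
    refine Ideal.add_mem _ (Ideal.span_mono (Set.image_mono Set.Iio_subset_Iic_self)
      (mem_span_image_of_evalOn_eq_zero α y (isLowerSet_Iio t) (fun s hs ↦ ih s hs) hg))
      (Ideal.mul_mem_right _ _ (Ideal.subset_span ⟨t, Set.self_mem_Iic, rfl⟩))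
  have hker {D : Set ι} (hD : IsLowerSet D) (f) : evalOn α D f = 0 ↔ f ∈ Ideal.span (y '' D) := by
    refine ⟨mem_span_image_of_evalOn_eq_zero α y hD fun s _ ↦ hIic s, fun hf ↦ ?_⟩
    suffices Ideal.span (y '' D) ≤ RingHom.ker (evalOn α D) from this hf
    rw [Ideal.span_le]
    rintro _ ⟨t, ht, rfl⟩
    exact evalOn_eq_zero_of_subset α (hD.Iic_subset ht) (hy0 t)
  refine ⟨y, ?_, fun t c hc ↦ ?_⟩
  · ext f
    rw [← Set.image_univ, ← hker isLowerSet_univ, RingHom.mem_ker]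
    have : evalOn α Set.univ f = algebraMap L _ (aeval α f) := by
      rw [evalOn, ← aeval_algebraMap_apply]
      congr 2
      ext u : 1
      simp [algebraMap_eq]
    rw [this, algebraMap_eq, C_eq_zero]
  · rw [← hker (isLowerSet_Iio t), map_mul, mul_eq_zero] at hc
    exact (hker (isLowerSet_Iio t) c).mp (hc.resolve_right (hy1 t))

end

end MvPolynomial

end FieldGenerators

section Lifting

/-- If the images of the `y t` under a surjection `π` form a (transfinite) regular sequence, then
the ideal `J` they generate satisfies `J ∩ ker π = ker π * J`. -/
theorem Ideal.span_range_inf_ker_le {ι A P : Type*} [LinearOrder ι] [WellFoundedLT ι] [CommRing A]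
    [CommRing P] {π : A →+* P} (hπ : Function.Surjective π) (y : ι → A)
    (hy : ∀ t c, c * π (y t) ∈ (Ideal.span (y '' Set.Iio t)).map π →
      c ∈ (Ideal.span (y '' Set.Iio t)).map π) :
    Ideal.span (Set.range y) ⊓ RingHom.ker π ≤ RingHom.ker π * Ideal.span (Set.range y) := by
  have hD {D : Set ι} (z : A) (hz : z ∈ Ideal.span (y '' D)) :
      z = 0 ∨ ∃ s ∈ D, z ∈ Ideal.span (y '' Set.Iic s) := by
    induction hz using Submodule.span_induction with
    | mem x hx =>
      obtain ⟨s, hs, rfl⟩ := hx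
      exact .inr ⟨s, hs, Ideal.subset_span ⟨s, Set.self_mem_Iic, rfl⟩⟩
    | zero => exact .inl rfl
    | add a b _ _ ha hb =>
      rcases ha with rfl | ⟨s, hs, ha⟩
      · rwa [zero_add]
      rcases hb with rfl | ⟨s', hs', hb⟩
      · rw [add_zero]; exact .inr ⟨s, hs, ha⟩
      refine .inr ⟨max s s', ?_, Ideal.add_mem _ ?_ ?_⟩
      · rcases max_choice s s' with h | h <;> rwa [h]
      · exact Ideal.span_mono (Set.image_mono (Set.Iic_subset_Iic.mpr (le_max_left _ _))) ha
      · exact Ideal.span_mono (Set.image_mono (Set.Iic_subset_Iic.mpr (le_max_right _ _))) hb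
    | smul a b _ hb =>
      rcases hb with rfl | ⟨s, hs, hb⟩
      · exact .inl (smul_zero a)
      · exact .inr ⟨s, hs, Ideal.mul_mem_left _ _ hb⟩
  have key (t : ι) : ∀ z ∈ Ideal.span (y '' Set.Iic t), π z = 0 →
      z ∈ RingHom.ker π * Ideal.span (Set.range y) := by
    induction t using WellFoundedLT.induction with
    | ind t ih =>
    intro z hz hπz
    rw [← Set.Iio_insert, Set.image_insert_eq] at hz
    obtain ⟨c, w, hw, rfl⟩ := Ideal.mem_span_insert.mp hz
    have hc : π c ∈ (Ideal.span (y '' Set.Iio t)).map π := by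
      refine hy t _ ?_
      rw [map_add, map_mul] at hπz
      rw [eq_neg_of_add_eq_zero_left hπz]
      exact neg_mem (Ideal.mem_map_of_mem _ hw)
    obtain ⟨c', hc', hcc⟩ := (Ideal.mem_map_iff_of_surjective _ hπ).mp hc
    have hcc0 : π (c - c') = 0 := by rw [map_sub, hcc, sub_self]
    have h1 : (c - c') * y t ∈ RingHom.ker π * Ideal.span (Set.range y) :=
      Ideal.mul_mem_mul hcc0 (Ideal.subset_span ⟨t, rfl⟩)
    have h2 : c * y t + w = (c - c') * y t + (c' * y t + w) := by ring
    rw [h2]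
    refine Ideal.add_mem _ h1 ?_
    rw [h2, map_add, map_mul, hcc0, zero_mul, zero_add] at hπz
    rcases hD (c' * y t + w) (Ideal.add_mem _ (Ideal.mul_mem_right _ _ hc') hw) with
      h | ⟨s, hs, h⟩
    · rw [h]; exact zero_mem _
    · exact ih s hs _ h hπz
  rintro z ⟨hz, hπz⟩
  rw [← Set.image_univ] at hz
  rcases hD z hz with rfl | ⟨s, -, h⟩
  · exact zero_mem _
  · exact key s z h hπz

open MvPolynomial in
theorem IsLocalRing.exists_ideal_inf_map_maximalIdeal_le {D S : Type*} [CommRing D] [IsLocalRing D]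
    [CommRing S] [IsLocalRing S] [Algebra D S] [IsLocalHom (algebraMap D S)]
    [Algebra.IsAlgebraic (ResidueField D) (ResidueField S)]
    (h : (maximalIdeal D).map (algebraMap D S) = maximalIdeal S) :
    ∃ J : Ideal (MvPolynomial S D), J ≤ RingHom.ker (aeval (R := D) (id : S → S)) ∧
      J ⊔ (maximalIdeal D).map C = (maximalIdeal S).comap (aeval (R := D) (id : S → S)) ∧
      J ⊓ (maximalIdeal D).map C ≤ (maximalIdeal D).map C * J := by
  obtain ⟨_, _⟩ := exists_wellFoundedLT S
  obtain ⟨y, hker, hreg⟩ := exists_generators_ker_aeval (K := ResidueField D) (residue S)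
  set φ : MvPolynomial S D →ₐ[D] S := aeval id
  let π : MvPolynomial S D →+* MvPolynomial S (ResidueField D) := map (residue D)
  have hπ : Function.Surjective π := map_surjective _ (residue_surjective)
  have hφ : Function.Surjective φ := fun s ↦ ⟨X s, by simp [φ]⟩
  have hπker : RingHom.ker π = (maximalIdeal D).map C := by
    rw [ker_map, ker_residue]
  have hπφ (a) : aeval (residue S) (π a) = residue S (φ a) := by
    change ((aeval (R := ResidueField D) (residue S)).toRingHom.comp π) a =
      ((residue S).comp φ.toRingHom) a
    congr 1
    refine ringHom_ext (fun d ↦ ?_) fun s ↦ ?_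
    · simp [π, φ]
    · simp [π, φ]
  have hmφ : ((maximalIdeal D).map C).map φ = maximalIdeal S := by
    have hφC : φ.toRingHom.comp C = algebraMap D S := φ.comp_algebraMap
    rw [← h, ← hφC]
    exact Ideal.map_map C φ.toRingHom
  have hlift (t) : ∃ z, φ z = 0 ∧ π z = y t := by
    obtain ⟨z, hz⟩ := hπ (y t)
    have h0 : residue S (φ z) = 0 := by
      rw [← hπφ, hz, ← RingHom.mem_ker, hker]
      exact Ideal.subset_span ⟨t, rfl⟩
    rw [residue_eq_zero_iff, ← hmφ] at h0
    obtain ⟨μ, hμ, hμz⟩ := (Ideal.mem_map_iff_of_surjective _ hφ).mp h0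
    rw [← hπker] at hμ
    exact ⟨z - μ, by rw [map_sub, hμz, sub_self], by rw [map_sub, hμ, sub_zero, hz]⟩
  choose z hz0 hzy using hlift
  have hspan (s : Set S) : (Ideal.span (z '' s)).map π = Ideal.span (y '' s) := by
    rw [Ideal.map_span, ← Set.image_comp]
    congr 2; funext t; exact hzy t
  refine ⟨Ideal.span (Set.range z), ?_, le_antisymm (sup_le ?_ ?_) fun a ha ↦ ?_, ?_⟩
  · rw [Ideal.span_le]
    rintro _ ⟨t, rfl⟩
    exact hz0 t
  · rw [Ideal.span_le]
    rintro _ ⟨t, rfl⟩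
    simp [hz0]
  · rw [← Ideal.map_le_iff_le_comap, hmφ]
  · have : π a ∈ RingHom.ker (aeval (R := ResidueField D) (residue S)) := by
      rw [RingHom.mem_ker, hπφ, residue_eq_zero_iff]; exact ha
    rw [hker, ← Set.image_univ, ← hspan, Set.image_univ, ← Ideal.mem_comap,
      Ideal.comap_map_of_surjective' _ hπ, hπker] at this
    exact this
  · rw [← hπker]
    refine Ideal.span_range_inf_ker_le hπ z fun t c ↦ ?_
    rw [hspan, hzy]
    exact hreg t c

end Lifting

section TranscendenceBasis

open MvPolynomial in
/-- A local homomorphism factors through a flat local unramified extension of its source such that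
the residue field extension of the second map is algebraic. -/
theorem IsLocalRing.exists_flat_isAlgebraic_residueField (R : Type u) (S : Type v) [CommRing R]
    [IsLocalRing R] [CommRing S] [IsLocalRing S] [Algebra R S] [IsLocalHom (algebraMap R S)] :
    ∃ (D : Type (max u v)) (_ : CommRing D) (_ : IsLocalRing D) (_ : Algebra R D) (_ : Algebra D S)
      (_ : IsScalarTower R D S) (_ : IsLocalHom (algebraMap D S)),
      Module.Flat R D ∧ (maximalIdeal R).map (algebraMap R D) = maximalIdeal D ∧
        Algebra.IsAlgebraic (ResidueField D) (ResidueField S) := by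
  obtain ⟨ι, x, hx⟩ := exists_isTranscendenceBasis' (ResidueField R) (ResidueField S)
  choose x' hx' using fun i ↦ residue_surjective (x i)
  let π : MvPolynomial ι R →+* MvPolynomial ι (ResidueField R) := map (residue R)
  let 𝔭 : Ideal (MvPolynomial ι R) := RingHom.ker π
  have h𝔭 : 𝔭 = (maximalIdeal R).map (algebraMap R (MvPolynomial ι R)) := by
    rw [← ker_residue, algebraMap_eq, ← ker_map]
  have : 𝔭.IsPrime := RingHom.ker_isPrime π
  let g₀ : MvPolynomial ι R →ₐ[R] S := aeval x'
  have hg₀ (f) : residue S (g₀ f) = aeval x (π f) := by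
    change ((residue S).comp g₀.toRingHom) f =
      ((aeval (R := ResidueField R) x).toRingHom.comp π) f
    congr 1
    exact ringHom_ext (fun d ↦ by simp [π, g₀]) fun s ↦ by simp [π, g₀, hx']
  have hunit (s : 𝔭.primeCompl) : IsUnit (g₀ s) := by
    rw [← residue_ne_zero_iff_isUnit, hg₀, ne_eq, ← map_zero (aeval (R := ResidueField R) x),
      hx.1.eq_iff]
    exact s.2
  let D := Localization.AtPrime 𝔭
  let g : D →ₐ[R] S := IsLocalization.liftAlgHom (M := 𝔭.primeCompl) (f := g₀) hunit
  have hgP (f : MvPolynomial ι R) : g (algebraMap (MvPolynomial ι R) D f) = g₀ f := IsLocalization.lift_eq _ _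
  let _ : Algebra D S := g.toRingHom.toAlgebra
  have htower : IsScalarTower R D S := .of_algebraMap_eq fun r ↦ (g.commutes r).symm
  have hmax : (maximalIdeal R).map (algebraMap R D) = maximalIdeal D := by
    rw [IsScalarTower.algebraMap_eq R (MvPolynomial ι R) D, ← Ideal.map_map, ← h𝔭]
    exact Localization.AtPrime.map_eq_maximalIdeal
  have hlocal : IsLocalHom (algebraMap D S) := by
    refine ((local_hom_TFAE (algebraMap D S)).out 2 0).mp ?_
    rw [← hmax, Ideal.map_map, ← IsScalarTower.algebraMap_eq]
    exact ((local_hom_TFAE (algebraMap R S)).out 0 2).mp ‹_›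
  have hflat : Module.Flat R D := .trans R (MvPolynomial ι R) D
  refine ⟨D, inferInstance, inferInstance, inferInstance, inferInstance, htower, hlocal, hflat,
    hmax, ⟨fun z ↦ ?_⟩⟩
  have hres (d : D) :
      algebraMap (ResidueField D) (ResidueField S) (residue D d) = residue S (g d) := rfl
  have hrange (a) (ha : a ∈ Algebra.adjoin (ResidueField R) (Set.range x)) :
      a ∈ (algebraMap (ResidueField D) (ResidueField S)).range := by
    induction ha using Algebra.adjoin_induction with
    | mem a ha =>
      obtain ⟨i, rfl⟩ := ha
      refine ⟨residue D (algebraMap (MvPolynomial ι R) D (X i)), ?_⟩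
      rw [hres, hgP, hg₀]
      simp [π]
    | algebraMap c =>
      obtain ⟨r, rfl⟩ := residue_surjective c
      exact ⟨residue D (algebraMap R D r), by rw [hres, g.commutes]; rfl⟩
    | add a b _ _ ha hb => exact add_mem ha hb
    | mul a b _ _ ha hb => exact mul_mem ha hb
  obtain ⟨p, hp0, hp⟩ := hx.isAlgebraic.isAlgebraic z
  have hlift : p.map (algebraMap _ (ResidueField S)) ∈
      Polynomial.lifts (algebraMap (ResidueField D) (ResidueField S)) := by
    refine (Polynomial.lifts_iff_coeff_lifts _).mpr fun n ↦ ?_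
    rw [Polynomial.coeff_map]
    exact hrange _ (p.coeff n).2
  obtain ⟨q, hq⟩ := (Polynomial.mem_lifts _).mp hlift
  refine ⟨q, ?_, ?_⟩
  · rintro rfl
    rw [Polynomial.map_zero, eq_comm, Polynomial.map_eq_zero_iff Subtype.val_injective] at hq
    exact hp0 hq
  · rw [← Polynomial.eval_map_algebraMap, hq, Polynomial.eval_map_algebraMap, hp]

/-- For an unramified local homomorphism `R → S`, there is a flat `R`-algebra `A` with a surjection
onto `S` and an ideal `J` in its kernel such that `A ⧸ J` has the same residue field as `S`
and `J ∩ 𝔪A = 𝔪J`. -/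
theorem IsLocalRing.exists_flat_surjective (R : Type u) (S : Type v) [CommRing R]
    [IsLocalRing R] [CommRing S] [IsLocalRing S] [Algebra R S] [IsLocalHom (algebraMap R S)]
    (h : (maximalIdeal R).map (algebraMap R S) = maximalIdeal S) :
    ∃ (A : Type (max u v)) (_ : CommRing A) (_ : Algebra R A) (_ : Module.Flat R A)
      (φ : A →ₐ[R] S) (J : Ideal A), Function.Surjective φ ∧ J ≤ RingHom.ker φ ∧
      J ⊔ (maximalIdeal R).map (algebraMap R A) = (maximalIdeal S).comap φ ∧
      J ⊓ (maximalIdeal R).map (algebraMap R A) ≤ (maximalIdeal R).map (algebraMap R A) * J := by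
  obtain ⟨D, _, _, _, _, _, _, _, hD, _⟩ := exists_flat_isAlgebraic_residueField R S
  have hDS : (maximalIdeal D).map (algebraMap D S) = maximalIdeal S := by
    rw [← hD, Ideal.map_map, ← IsScalarTower.algebraMap_eq, h]
  obtain ⟨J, hJ, hJD, hJm⟩ := exists_ideal_inf_map_maximalIdeal_le (D := D) (S := S) hDS
  have hC : (maximalIdeal D).map MvPolynomial.C =
      (maximalIdeal R).map (algebraMap R (MvPolynomial S D)) := by
    rw [← hD, Ideal.map_map]
    rfl
  rw [hC] at hJD hJm
  exact ⟨MvPolynomial S D, inferInstance, inferInstance, .trans R D _,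
    (MvPolynomial.aeval (R := D) (id : S → S)).restrictScalars R, J,
    fun s ↦ ⟨MvPolynomial.X s, by simp⟩, hJ, hJD, hJm⟩

end TranscendenceBasis

section Completion

namespace AdicCompletion

theorem ker_evalₐ {B : Type*} [CommRing B] (I : Ideal B) (hI : I.FG) (n : ℕ) :
    RingHom.ker (evalₐ I n) = (I ^ n).map (algebraMap B (AdicCompletion I B)) := by
  ext x
  have hle : I ^ n • (⊤ : Ideal B) ≤ I ^ n := by rw [smul_eq_mul, Ideal.mul_top]
  have hle' : I ^ n ≤ I ^ n • (⊤ : Ideal B) := by rw [smul_eq_mul, Ideal.mul_top]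
  rw [← Submodule.restrictScalars_mem B (Ideal.map _ _), ← Ideal.smul_top_eq_map,
    pow_smul_top_eq_ker_eval hI, RingHom.mem_ker, LinearMap.mem_ker]
  constructor
  · intro h
    rw [← factor_evalₐ_eq_eval I x hle', h]
    exact RingHom.map_zero _
  · intro h
    rw [← factor_eval_eq_evalₐ I x hle, h]
    exact LinearMap.map_zero (Submodule.factor hle)

/-- Extension of a ring homomorphism to the adic completion of its source. -/
theorem exists_ringHom_comp_algebraMap_eq {B C : Type*} [CommRing B] [CommRing C] (I : Ideal B)
    (K : Ideal C) [IsAdicComplete K C] (g : B →+* C) (h : I.map g ≤ K) :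
    ∃ ψ : AdicCompletion I B →+* C, ψ.comp (algebraMap B (AdicCompletion I B)) = g := by
  have hn (n : ℕ) : I ^ n ≤ (K ^ n).comap g := by
    rw [← Ideal.map_le_iff_le_comap, Ideal.map_pow]
    exact Ideal.pow_right_mono h n
  let F (n : ℕ) : AdicCompletion I B →+* C ⧸ K ^ n :=
    (Ideal.quotientMap (K ^ n) g (hn n)).comp (evalₐ I n : AdicCompletion I B →+* B ⧸ I ^ n)
  have hF {m n : ℕ} (hle : m ≤ n) : (Ideal.Quotient.factorPow K hle).comp (F n) = F m := by
    ext x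
    obtain ⟨x, rfl⟩ := mk_surjective I B x
    simp only [F, RingHom.comp_apply, RingHom.coe_coe, evalₐ_mk, Ideal.quotientMap_mk,
      Ideal.Quotient.factor_mk]
    rw [← Ideal.quotientMap_mk (H := hn m), ← Ideal.quotientMap_mk (H := hn m),
      Ideal.mk_eq_mk I hle]
  refine ⟨IsAdicComplete.liftRingHom K F hF, ?_⟩
  ext b
  rw [← sub_eq_zero]
  refine (inferInstance : IsHausdorff K C).haus' _ fun n ↦ ?_
  rw [SModEq.zero, smul_eq_mul, Ideal.mul_top, ← Ideal.Quotient.eq_zero_iff_mem, map_sub,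
    RingHom.comp_apply, IsAdicComplete.mk_liftRingHom]
  simp [F, algebraMap_apply]

variable {B : Type*} [CommRing B] (I : Ideal B)

theorem isAdicComplete_map_of_fg (hI : I.FG) :
    IsAdicComplete (I.map (algebraMap B (AdicCompletion I B))) (AdicCompletion I B) :=
  isAdicComplete_self I hI

theorem isMaximal_map_of_isMaximal [I.IsMaximal] (hI : I.FG) :
    (I.map (algebraMap B (AdicCompletion I B))).IsMaximal :=
  isMaximal_map_of_le I I le_rfl hI

theorem isLocalRing_of_isMaximal [I.IsMaximal] (hI : I.FG) : IsLocalRing (AdicCompletion I B) :=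
  have := isMaximal_map_of_isMaximal I hI
  have := isAdicComplete_map_of_fg I hI
  isLocalRing_of_isAdicComplete_maximal (I.map (algebraMap B (AdicCompletion I B)))

theorem isNoetherianRing_of_isMaximal [I.IsMaximal] (hI : I.FG) :
    IsNoetherianRing (AdicCompletion I B) :=
  have := isMaximal_map_of_isMaximal I hI
  have := isAdicComplete_map_of_fg I hI
  letI := Ideal.Quotient.field (I.map (algebraMap B (AdicCompletion I B)))
  IsAdicComplete.isNoetherianRing (I.map (algebraMap B (AdicCompletion I B))) (hI.map _)

theorem surjective_of_comp_algebraMap_eq {C : Type*} [CommRing C] (hI : I.FG)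
    {g : B →+* C} [IsHausdorff (I.map g) C]
    (h : Function.Surjective ((Ideal.Quotient.mk (I.map g)).comp g))
    {ψ : AdicCompletion I B →+* C} (hψ : ψ.comp (algebraMap B (AdicCompletion I B)) = g) :
    Function.Surjective ψ := by
  subst hψ
  have := isAdicComplete_map_of_fg I hI
  have : IsHausdorff ((I.map (algebraMap B (AdicCompletion I B))).map ψ) C := by
    rwa [Ideal.map_map]
  refine surjective_of_mk_map_comp_surjective
    (I := I.map (algebraMap B (AdicCompletion I B))) ψ ?_
  rw [← RingHom.comp_assoc] at h
  rw [Ideal.map_map]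
  exact Function.Surjective.of_comp h

end AdicCompletion

/-- The completion of `A ⧸ J` is flat over `R` if `A` is and `J ∩ 𝔪A = 𝔪J`. -/
theorem Module.Flat.adicCompletion_quotient {R A : Type*} [CommRing R] [IsLocalRing R]
    [IsNoetherianRing R] [CommRing A] [Algebra R A] [Module.Flat R A] {J : Ideal A}
    (hJ : J ⊓ (maximalIdeal R).map (algebraMap R A) ≤ (maximalIdeal R).map (algebraMap R A) * J)
    {I : Ideal (A ⧸ J)} [I.IsMaximal] (hI : I = (maximalIdeal R).map (algebraMap R (A ⧸ J))) :
    Module.Flat R (AdicCompletion I (A ⧸ J)) := by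
  have hIfg : I.FG := hI ▸ Ideal.FG.map (IsNoetherian.noetherian _) _
  have := AdicCompletion.isNoetherianRing_of_isMaximal I hIfg
  have := AdicCompletion.isAdicComplete_map_of_fg I hIfg
  have hpow (N : ℕ) : (maximalIdeal R ^ N).map (algebraMap R (AdicCompletion I (A ⧸ J))) =
      RingHom.ker (AdicCompletion.evalₐ I N) := by
    rw [AdicCompletion.ker_evalₐ I hIfg, Ideal.map_pow, Ideal.map_pow,
      IsScalarTower.algebraMap_eq R (A ⧸ J) (AdicCompletion I (A ⧸ J)), ← Ideal.map_map, ← hI]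
  have hIN (N : ℕ) : I ^ N = (maximalIdeal R ^ N).map (algebraMap R (A ⧸ J)) := by
    rw [hI, Ideal.map_pow]
  let φ : A →ₐ[R] AdicCompletion I (A ⧸ J) :=
    (IsScalarTower.toAlgHom R (A ⧸ J) (AdicCompletion I (A ⧸ J))).comp (Ideal.Quotient.mkₐ R J)
  have hφ (N : ℕ) (a : A) : AdicCompletion.evalₐ I N (φ a) =
      Ideal.Quotient.mk (I ^ N) (Ideal.Quotient.mk J a) := by
    simp [φ, AdicCompletion.algebraMap_apply]
  refine Module.Flat.of_inf_map_maximalIdeal_le ?_ hJ φ (fun x hx ↦ ?_) (fun N t ↦ ?_)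
    (fun N a h ↦ ?_)
  · rw [IsScalarTower.algebraMap_eq R (A ⧸ J) (AdicCompletion I (A ⧸ J)), ← Ideal.map_map, ← hI]
    exact IsAdicComplete.le_jacobson_bot _
  · simp [φ, Ideal.Quotient.eq_zero_iff_mem.mpr hx]
  · obtain ⟨b, hb⟩ := Ideal.Quotient.mk_surjective (AdicCompletion.evalₐ I N t)
    obtain ⟨a, rfl⟩ := Ideal.Quotient.mk_surjective b
    refine ⟨a, ?_⟩
    rw [hpow, RingHom.mem_ker, map_sub, hφ, hb, sub_self]
  · rw [hpow, RingHom.mem_ker, hφ, Ideal.Quotient.eq_zero_iff_mem, hIN,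
      IsScalarTower.algebraMap_eq R A (A ⧸ J), ← Ideal.map_map] at h
    have h' : a ∈ ((((maximalIdeal R) ^ N).map (algebraMap R A)).map
        (Ideal.Quotient.mk J)).comap (Ideal.Quotient.mk J) := h
    rwa [Ideal.comap_map_of_surjective _ Ideal.Quotient.mk_surjective, ← RingHom.ker_eq_comap_bot,
      Ideal.mk_ker, sup_comm] at h'

/-- A surjection onto `S` extends to a surjection between the completions. -/
theorem AdicCompletion.exists_algHom_surjective_of_map_eq {R S B : Type*} [CommRing R]
    [IsLocalRing R] [IsNoetherianRing R] [CommRing S] [IsLocalRing S] [IsNoetherianRing S]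
    [Algebra R S] [CommRing B] [Algebra R B]
    (h : (maximalIdeal R).map (algebraMap R S) = maximalIdeal S) {I : Ideal B}
    (hI : I = (maximalIdeal R).map (algebraMap R B)) (g : B →ₐ[R] S)
    (hg : Function.Surjective g) :
    ∃ ψ : AdicCompletion I B →ₐ[R] AdicCompletion (maximalIdeal S) S, Function.Surjective ψ := by
  have hIfg : I.FG := hI ▸ Ideal.FG.map (IsNoetherian.noetherian _) _
  obtain ⟨g', hg'⟩ : ∃ g' : B →+* AdicCompletion (maximalIdeal S) S,
      g' = (algebraMap S (AdicCompletion (maximalIdeal S) S)).comp g := ⟨_, rfl⟩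
  have hgR : g'.comp (algebraMap R B) = algebraMap R (AdicCompletion (maximalIdeal S) S) := by
    rw [hg', RingHom.comp_assoc, AlgHom.comp_algebraMap, ← IsScalarTower.algebraMap_eq]
  have hIg : I.map g' = maximalIdeal (AdicCompletion (maximalIdeal S) S) := by
    rw [hI, Ideal.map_map, hgR,
      IsScalarTower.algebraMap_eq R S (AdicCompletion (maximalIdeal S) S), ← Ideal.map_map, h,
      AdicCompletion.maximalIdeal_eq_map]
  obtain ⟨ψ, hψ⟩ := AdicCompletion.exists_ringHom_comp_algebraMap_eq I
    (maximalIdeal (AdicCompletion (maximalIdeal S) S)) g' hIg.le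
  refine ⟨{ ψ with commutes' := fun r ↦ ?_ }, ?_⟩
  · have := RingHom.congr_fun hψ (algebraMap R B r)
    rw [RingHom.comp_apply, ← IsScalarTower.algebraMap_apply] at this
    exact this.trans (RingHom.congr_fun hgR r)
  · have : IsHausdorff (I.map g') (AdicCompletion (maximalIdeal S) S) := by
      rw [hIg]; infer_instance
    refine AdicCompletion.surjective_of_comp_algebraMap_eq I hIfg (fun x ↦ ?_) hψ
    obtain ⟨x, rfl⟩ := Ideal.Quotient.mk_surjective x
    obtain ⟨s, hs⟩ := (AdicCompletion.residueField_map_bijective S).2 (residue _ x)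
    obtain ⟨s, rfl⟩ := residue_surjective s
    obtain ⟨b, rfl⟩ := hg s
    refine ⟨b, ?_⟩
    rw [ResidueField.map_residue, ← sub_eq_zero, ← map_sub, residue_eq_zero_iff, ← hIg] at hs
    rw [RingHom.comp_apply, Ideal.Quotient.eq]
    exact (RingHom.congr_fun hg' b).symm ▸ hs

/-- The completion of a local unramified `R`-algebra is a quotient of a Noetherian local flat
unramified `R`-algebra. -/
theorem IsLocalRing.exists_flat_surjective_adicCompletion (R : Type u) (S : Type v) [CommRing R]
    [IsLocalRing R] [IsNoetherianRing R] [CommRing S] [IsLocalRing S] [IsNoetherianRing S]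
    [Algebra R S] [IsLocalHom (algebraMap R S)]
    (h : (maximalIdeal R).map (algebraMap R S) = maximalIdeal S) :
    ∃ (T : Type (max u v)) (_ : CommRing T) (_ : IsNoetherianRing T) (_ : IsLocalRing T)
      (_ : Algebra R T) (_ : Module.Flat R T) (ψ : T →ₐ[R] AdicCompletion (maximalIdeal S) S),
      (maximalIdeal R).map (algebraMap R T) = maximalIdeal T ∧ Function.Surjective ψ := by
  obtain ⟨A, _, _, _, φ, J, hφ, hJφ, hJmax, hJ⟩ := IsLocalRing.exists_flat_surjective R S h
  obtain ⟨I, hI⟩ : ∃ I : Ideal (A ⧸ J), I = (maximalIdeal R).map (algebraMap R (A ⧸ J)) :=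
    ⟨_, rfl⟩
  have hIfg : I.FG := hI ▸ Ideal.FG.map (IsNoetherian.noetherian _) _
  have hIcomap : I.comap (Ideal.Quotient.mk J) = (maximalIdeal S).comap φ := by
    rw [hI, IsScalarTower.algebraMap_eq R A (A ⧸ J), ← Ideal.map_map,
      Ideal.Quotient.algebraMap_eq, Ideal.comap_map_of_surjective _ Ideal.Quotient.mk_surjective,
      ← RingHom.ker_eq_comap_bot, Ideal.mk_ker, sup_comm, hJmax]
  have hImax : I.IsMaximal := by
    have := Ideal.comap_isMaximal_of_surjective φ hφ (K := maximalIdeal S)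
    rw [← hIcomap] at this
    rw [← Ideal.map_comap_of_surjective _ Ideal.Quotient.mk_surjective I]
    refine (Ideal.map_eq_top_or_isMaximal_of_surjective _ Ideal.Quotient.mk_surjective
      this).resolve_left fun htop ↦ this.ne_top ?_
    rw [← Ideal.map_comap_of_surjective _ Ideal.Quotient.mk_surjective I, htop, Ideal.comap_top]
  have hg : Function.Surjective (Ideal.Quotient.liftₐ J φ hJφ) := fun s ↦ by
    obtain ⟨a, rfl⟩ := hφ s
    exact ⟨Ideal.Quotient.mk J a, rfl⟩
  obtain ⟨ψ, hψ⟩ := AdicCompletion.exists_algHom_surjective_of_map_eq h hI _ hg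
  have hloc := AdicCompletion.isLocalRing_of_isMaximal I hIfg
  have hmap : (maximalIdeal R).map (algebraMap R (AdicCompletion I (A ⧸ J))) =
      maximalIdeal (AdicCompletion I (A ⧸ J)) := by
    rw [IsScalarTower.algebraMap_eq R (A ⧸ J) (AdicCompletion I (A ⧸ J)), ← Ideal.map_map, ← hI]
    exact IsLocalRing.eq_maximalIdeal (AdicCompletion.isMaximal_map_of_isMaximal I hIfg)
  exact ⟨AdicCompletion I (A ⧸ J), inferInstance,
    AdicCompletion.isNoetherianRing_of_isMaximal I hIfg, hloc, inferInstance,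
    Module.Flat.adicCompletion_quotient hJ hI, ψ, hmap, hψ⟩

end Completion

section Main

open TensorProduct in
/-- Flatness descends along faithfully flat maps out of the target. -/
theorem Module.Flat.of_flat_of_faithfullyFlat (R S T : Type*) [CommRing R] [CommRing S]
    [CommRing T] [Algebra R S] [Algebra S T] [Algebra R T] [IsScalarTower R S T]
    [Module.Flat R T] [Module.FaithfullyFlat S T] : Module.Flat R S := by
  rw [Module.Flat.iff_lTensor_preserves_injective_linearMap]
  intro N P _ _ _ _ f hf
  have h : Function.Injective (LinearMap.lTensor T (f.baseChange S)) := by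
    have hc : (f.baseChange T) ∘ₗ
        (AlgebraTensorModule.cancelBaseChange R S T T N).toLinearMap =
        (AlgebraTensorModule.cancelBaseChange R S T T P).toLinearMap ∘ₗ
          ((f.baseChange S).baseChange T) := by
      ext; simp
    have hinj : Function.Injective ((AlgebraTensorModule.cancelBaseChange R S T T P) ∘
        ((f.baseChange S).baseChange T)) := by
      have := (Module.Flat.lTensor_preserves_injective_linearMap (M := T) f hf).comp
        (AlgebraTensorModule.cancelBaseChange R S T T N).injective
      convert this using 1
      exact congr_arg DFunLike.coe hc.symm
    exact Function.Injective.of_comp hinj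
  exact (Module.FaithfullyFlat.lTensor_injective_iff_injective S T (f.baseChange S)).mp h

theorem IsLocalRing.ringKrullDim_le_of_map_maximalIdeal_eq {R T : Type*} [CommRing R]
    [IsLocalRing R] [IsNoetherianRing R] [CommRing T] [IsLocalRing T] [IsNoetherianRing T]
    [Algebra R T] (h : (maximalIdeal R).map (algebraMap R T) = maximalIdeal T) :
    ringKrullDim T ≤ ringKrullDim R := by
  have : IsLocalHom (algebraMap R T) := ((local_hom_TFAE (algebraMap R T)).out 0 2).mpr h.le
  have := Ideal.height_le_height_add_of_liesOver (maximalIdeal R) (maximalIdeal T)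
  rw [h, Ideal.map_quotient_self, Ideal.height_bot, add_zero] at this
  rw [← maximalIdeal_height_eq_ringKrullDim, ← maximalIdeal_height_eq_ringKrullDim]
  exact_mod_cast this

theorem IsLocalRing.ringKrullDim_le_of_flat {R T : Type*} [CommRing R]
    [IsLocalRing R] [IsNoetherianRing R] [CommRing T] [IsLocalRing T] [IsNoetherianRing T]
    [Algebra R T] [IsLocalHom (algebraMap R T)] [Module.Flat R T] :
    ringKrullDim R ≤ ringKrullDim T := by
  have := Ideal.height_eq_height_add_of_liesOver_of_hasGoingDown (maximalIdeal R) (maximalIdeal T)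
  rw [← maximalIdeal_height_eq_ringKrullDim, ← maximalIdeal_height_eq_ringKrullDim]
  exact_mod_cast this ▸ le_self_add

theorem RingHom.injective_of_surjective_of_ringKrullDim_le {T C : Type*} [CommRing T] [IsDomain T]
    [FiniteRingKrullDim T] [CommRing C] (ψ : T →+* C) (hψ : Function.Surjective ψ)
    (h : ringKrullDim T ≤ ringKrullDim C) : Function.Injective ψ := by
  rw [injective_iff_map_eq_zero]
  intro x hx
  by_contra hx0
  have h1 := ringKrullDim_quotient_succ_le_of_nonZeroDivisor (mem_nonZeroDivisors_of_ne_zero hx0)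
  have h2 : ringKrullDim C ≤ ringKrullDim (T ⧸ Ideal.span {x}) :=
    ringKrullDim_le_of_surjective
      (Ideal.Quotient.lift (Ideal.span {x}) ψ fun a ha ↦ by
        obtain ⟨b, rfl⟩ := Ideal.mem_span_singleton.mp ha
        rw [map_mul, hx, zero_mul])
      (Ideal.Quotient.lift_surjective_of_surjective _ _ hψ)
  have h3 : ringKrullDim T + 1 ≤ ringKrullDim T := by
    refine le_trans ?_ h1
    gcongr
    exact h.trans h2
  obtain ⟨n, hn⟩ := WithBot.ne_bot_iff_exists.mp (ringKrullDim_ne_bot (R := T))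
  have htop : n ≠ ⊤ := fun h ↦ ringKrullDim_ne_top (R := T) (by rw [← hn, h]; rfl)
  rw [← hn] at h3
  have h4 : n + 1 ≤ n := by exact_mod_cast h3
  exact absurd h4 (not_le.mpr ((ENat.lt_add_one_iff htop).mpr le_rfl))

/-- let `R → S` be a local homomorphism of Noetherian local rings, and assume that
every scalar extension of `R` is an integral domain (`R` is universally irreducible). If the
homomorphism is unramified (`m_R · S = m_S`) and `dim R = dim S`, then `R → S` is faithfully
flat, and hence a scalar extension. -/
theorem flatness_criterion_universally_irreducible
    {R : Type u} {S : Type v} [CommRing R] [CommRing S]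
    [IsNoetherianRing R] [IsNoetherianRing S] [IsLocalRing R] [IsLocalRing S]
    (f : R →+* S) (hloc : IsLocalHom f)
    (huniv : ∀ (T : Type (max u v)) (_ : CommRing T) (_ : IsNoetherianRing T)
      (_ : IsLocalRing T) (g : R →+* T), IsLocalHom g → IsScalarExtension g → IsDomain T)
    (hunr : (maximalIdeal R).map f = maximalIdeal S)
    (hdim : ringKrullDim R = ringKrullDim S) :
    (letI : Algebra R S := f.toAlgebra; Module.FaithfullyFlat R S) ∧ IsScalarExtension f := by
  algebraize [f]
  have hfl : IsLocalHom (algebraMap R S) := hloc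
  obtain ⟨T, _, _, _, _, _, ψ, hT, hψ⟩ :=
    IsLocalRing.exists_flat_surjective_adicCompletion R S hunr
  have hTl : IsLocalHom (algebraMap R T) := ((local_hom_TFAE (algebraMap R T)).out 0 2).mpr hT.le
  have : Module.FaithfullyFlat R T := .of_flat_of_isLocalHom
  have : IsDomain T := huniv T _ ‹_› ‹_› (algebraMap R T) hTl
    ⟨RingHom.faithfullyFlat_algebraMap_iff.mpr this, hT⟩
  have : IsNoetherianRing (AdicCompletion (maximalIdeal S) S) :=
    isNoetherianRing_of_surjective _ _ (ψ : T →+* _) hψ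
  have hdimT : ringKrullDim T ≤ ringKrullDim (AdicCompletion (maximalIdeal S) S) :=
    (IsLocalRing.ringKrullDim_le_of_map_maximalIdeal_eq hT).trans
      (hdim.le.trans IsLocalRing.ringKrullDim_le_of_flat)
  have hinj := RingHom.injective_of_surjective_of_ringKrullDim_le (ψ : T →+* _) hψ hdimT
  have : Module.Flat R (AdicCompletion (maximalIdeal S) S) :=
    Module.Flat.of_linearEquiv (AlgEquiv.ofBijective ψ ⟨hinj, hψ⟩).symm.toLinearEquiv
  have : Module.FaithfullyFlat S (AdicCompletion (maximalIdeal S) S) := .of_flat_of_isLocalHom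
  have : Module.Flat R S :=
    Module.Flat.of_flat_of_faithfullyFlat R S (AdicCompletion (maximalIdeal S) S)
  have : Module.FaithfullyFlat R S := .of_flat_of_isLocalHom
  exact ⟨this, this, hunr⟩

end Main
end

section
/- If R and S are similar Noetherian local rings, then: dim R = dim S (equal Krull dimensions); for every n ≥ 1 the R-module R/m_R^n and the S-module S/m_S^n have the same finite length (so R and S have the same Hilbert–Samuel function, equivalently the same Hilbert series); and R is a regular local ring if and only if S is a regular local ring. -/
open IsLocalRing

universe u v

/-- Two local rings are *similar* if they admit a common scalar extension which is a Noetherian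
local ring. -/
def AreSimilar (R : Type u) (S : Type v) [CommRing R] [CommRing S]
    [IsLocalRing R] [IsLocalRing S] : Prop :=
  ∃ (T : Type (max u v)) (_ : CommRing T) (_ : IsNoetherianRing T) (_ : IsLocalRing T)
    (f : R →+* T) (g : S →+* T) (_ : IsLocalHom f) (_ : IsLocalHom g),
    IsScalarExtension f ∧ IsScalarExtension g

/-- `M` is an `R`-module of finite length `k`: it has a composition series of length `k`
from `⊥` to `⊤`. -/
def HasLength (R : Type*) (M : Type*) [Ring R] [AddCommGroup M] [Module R M] (k : ℕ) : Prop :=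
  ∃ s : CompositionSeries (Submodule R M), s.head = ⊥ ∧ s.last = ⊤ ∧ s.length = k

/-- A Noetherian local ring is *regular* if its Krull dimension equals its embedding dimension,
the dimension of `m/m²` over the residue field. -/
def IsRegularLocal (R : Type*) [CommRing R] [IsLocalRing R] : Prop :=
  ringKrullDim R = (Module.finrank (ResidueField R) (CotangentSpace R) : WithBot (WithTop ℕ))

open Module in
/-- A scalar extension preserves the length of the quotient by a power of the maximal ideal. -/
theorem IsLocalRing.length_quotient_maximalIdeal_pow_eq {A B : Type*} [CommRing A] [CommRing B]
    [IsLocalRing A] [IsLocalRing B] [Algebra A B] [IsLocalHom (algebraMap A B)] [Flat A B]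
    (hm : (maximalIdeal A).map (algebraMap A B) = maximalIdeal B) (n : ℕ) :
    Module.length A (A ⧸ maximalIdeal A ^ n) = Module.length B (B ⧸ maximalIdeal B ^ n) := by
  have h := IsLocalRing.length_baseChange A B (A ⧸ maximalIdeal A ^ n)
  have : IsSimpleModule B (B ⧸ maximalIdeal B) :=
    isSimpleModule_iff_isCoatom.mpr (maximalIdeal.isMaximal B).out
  rw [hm, Module.length_eq_one B (B ⧸ maximalIdeal B), mul_one,
    ← (Algebra.TensorProduct.quotIdealMapEquivTensorQuot B
      (maximalIdeal A ^ n)).toLinearEquiv.length_eq, Ideal.map_pow, hm] at h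
  exact h.symm

open Module in
/-- A flat extension of Noetherian local rings with `m_A B = m_B` preserves the Krull dimension. -/
theorem IsLocalRing.ringKrullDim_eq_of_flat_of_map_maximalIdeal {A B : Type*} [CommRing A]
    [CommRing B] [IsNoetherianRing A] [IsNoetherianRing B] [IsLocalRing A] [IsLocalRing B]
    [Algebra A B] [IsLocalHom (algebraMap A B)] [Flat A B]
    (hm : (maximalIdeal A).map (algebraMap A B) = maximalIdeal B) :
    ringKrullDim A = ringKrullDim B := by
  have h := Ideal.height_eq_height_add_of_liesOver_of_hasGoingDown
    (maximalIdeal A) (maximalIdeal B)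
  rw [hm, Ideal.map_quotient_self, Ideal.height_bot, add_zero] at h
  rw [← maximalIdeal_height_eq_ringKrullDim, ← maximalIdeal_height_eq_ringKrullDim, h]

/-- The length of `R/m²` exceeds the embedding dimension of `R` by one. -/
theorem IsLocalRing.length_quotient_maximalIdeal_sq (R : Type*) [CommRing R] [IsNoetherianRing R]
    [IsLocalRing R] :
    Module.length R (R ⧸ maximalIdeal R ^ 2) =
      Module.finrank (ResidueField R) (CotangentSpace R) + 1 := by
  have : IsSimpleModule R (R ⧸ maximalIdeal R) :=
    isSimpleModule_iff_isCoatom.mpr (maximalIdeal.isMaximal R).out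
  have hle : maximalIdeal R ^ 2 ≤ maximalIdeal R := Ideal.pow_le_self two_ne_zero
  have hex : Function.Exact (maximalIdeal R).cotangentToQuotientSquare (Submodule.factor hle) := by
    rw [LinearMap.exact_iff, Ideal.range_cotangentToQuotientSquare]
    ext x
    obtain ⟨x, rfl⟩ := Ideal.Quotient.mk_surjective x
    rw [Submodule.restrictScalars_mem, Ideal.mk_mem_cotangentIdeal]
    exact Submodule.Quotient.mk_eq_zero _
  rw [Module.length_eq_add_of_exact _ _ (maximalIdeal R).cotangentToQuotientSquare_injective
    (Submodule.factor_surjective hle) hex,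
    Module.length_eq_one R (R ⧸ maximalIdeal R),
    ← Module.length_eq_finrank (ResidueField R) (CotangentSpace R),
    ← Module.length_eq_of_surjective (S := R) (M := CotangentSpace R)
      (residue_surjective (R := R))]

/-- The quotient of a Noetherian local ring by a positive power of the maximal ideal has finite
length. -/
theorem IsLocalRing.isFiniteLength_quotient_maximalIdeal_pow (R : Type*) [CommRing R]
    [IsNoetherianRing R] [IsLocalRing R] {n : ℕ} (hn : n ≠ 0) :
    IsFiniteLength R (R ⧸ maximalIdeal R ^ n) := by
  have : IsArtinianRing (R ⧸ maximalIdeal R ^ n) :=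
    quotient_artinian_of_mem_minimalPrimes_of_isLocalRing _
      ⟨⟨inferInstance, Ideal.pow_le_self hn⟩, fun _ hq _ ↦ hq.1.le_of_pow_le hq.2⟩
  exact isFiniteLength_iff_isNoetherian_isArtinian.mpr ⟨inferInstance,
    isArtinian_of_surjective_algebraMap
      (Ideal.Quotient.mk_surjective (I := maximalIdeal R ^ n))⟩

theorem IsFiniteLength.exists_hasLength {R M : Type*} [Ring R] [AddCommGroup M] [Module R M]
    (h : IsFiniteLength R M) : ∃ k : ℕ, HasLength R M k ∧ Module.length R M = k := by
  obtain ⟨s, hs₁, hs₂⟩ := isFiniteLength_iff_exists_compositionSeries.mp h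
  exact ⟨s.length, ⟨s, hs₁, hs₂, rfl⟩, (Module.length_compositionSeries s hs₁ hs₂).symm⟩

section ScalarExtension

variable {R S : Type*} [CommRing R] [CommRing S] [IsLocalRing R] [IsLocalRing S] {f : R →+* S}
  [IsLocalHom f]

theorem IsScalarExtension.length_quotient_maximalIdeal_pow_eq (hf : IsScalarExtension f) (n : ℕ) :
    Module.length R (R ⧸ maximalIdeal R ^ n) = Module.length S (S ⧸ maximalIdeal S ^ n) := by
  algebraize [f]
  have : Module.FaithfullyFlat R S := hf.1
  exact IsLocalRing.length_quotient_maximalIdeal_pow_eq hf.2 n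

theorem IsScalarExtension.ringKrullDim_eq [IsNoetherianRing R] [IsNoetherianRing S]
    (hf : IsScalarExtension f) : ringKrullDim R = ringKrullDim S := by
  algebraize [f]
  have : Module.FaithfullyFlat R S := hf.1
  exact IsLocalRing.ringKrullDim_eq_of_flat_of_map_maximalIdeal hf.2

end ScalarExtension

/-- similar Noetherian local rings have the same Krull dimension, the same
Hilbert–Samuel function (for each `n ≥ 1` the modules `R/m_R^n` and `S/m_S^n` have the same
finite length), and one is regular iff the other is. -/
theorem areSimilar_invariants
    {R : Type u} {S : Type v} [CommRing R] [CommRing S]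
    [IsNoetherianRing R] [IsNoetherianRing S] [IsLocalRing R] [IsLocalRing S]
    (h : AreSimilar R S) :
    ringKrullDim R = ringKrullDim S ∧
    (∀ n : ℕ, 1 ≤ n → ∃ k : ℕ,
      HasLength R (R ⧸ maximalIdeal R ^ n) k ∧ HasLength S (S ⧸ maximalIdeal S ^ n) k) ∧
    (IsRegularLocal R ↔ IsRegularLocal S) := by
  obtain ⟨T, _, _, _, f, g, _, _, hf, hg⟩ := h
  have hdim : ringKrullDim R = ringKrullDim S := hf.ringKrullDim_eq.trans hg.ringKrullDim_eq.symm
  have hlen (n : ℕ) :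
      Module.length R (R ⧸ maximalIdeal R ^ n) = Module.length S (S ⧸ maximalIdeal S ^ n) :=
    (hf.length_quotient_maximalIdeal_pow_eq n).trans
      (hg.length_quotient_maximalIdeal_pow_eq n).symm
  refine ⟨hdim, fun n hn ↦ ?_, ?_⟩
  · obtain ⟨k, hk, hRk⟩ :=
      (isFiniteLength_quotient_maximalIdeal_pow R (Nat.one_le_iff_ne_zero.mp hn)).exists_hasLength
    obtain ⟨l, hl, hSl⟩ :=
      (isFiniteLength_quotient_maximalIdeal_pow S (Nat.one_le_iff_ne_zero.mp hn)).exists_hasLength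
    obtain rfl : k = l := by exact_mod_cast hRk.symm.trans ((hlen n).trans hSl)
    exact ⟨k, hk, hl⟩
  · have h := hlen 2
    rw [length_quotient_maximalIdeal_sq, length_quotient_maximalIdeal_sq] at h
    have hfin : Module.finrank (ResidueField R) (CotangentSpace R) =
        Module.finrank (ResidueField S) (CotangentSpace S) := by
      exact Nat.succ_injective (by exact_mod_cast h)
    rw [IsRegularLocal, IsRegularLocal, hdim, hfin]
end

section
/- If R and S are Noetherian local rings that are elementarily equivalent as structures in the first-order language of rings, then R and S are similar. -/
open IsLocalRing

universe u v

section ModelTheory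

open FirstOrder FirstOrder.Language FirstOrder.Ring Filter

/-- A map preserving the truth of all first-order formulas. -/
def PreservesFormulas (L : Language) {M N : Type*} [L.Structure M] [L.Structure N]
    (f : M → N) : Prop :=
  ∀ φ : L.Formula M, φ.Realize id → φ.Realize f

theorem PreservesFormulas.realize_sentence {L : Language} {M N : Type*} [L.Structure M]
    [L.Structure N] {f : M → N} (hf : PreservesFormulas L f) {φ : L.Sentence} (h : M ⊨ φ) :
    N ⊨ φ := by
  have := hf (φ.relabel (Empty.elim : Empty → M))
  rw [Formula.realize_relabel, Formula.realize_relabel] at this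
  rw [Sentence.Realize] at h ⊢
  convert this (by convert h)

theorem exists_realize_of_elementarilyEquivalent {L : Language} {M : Type u} {N : Type v}
    [L.Structure M] [L.Structure N] [Nonempty M] (h : L.ElementarilyEquivalent M N)
    (φ : L.Formula N) (hφ : φ.Realize id) : ∃ w : N → M, φ.Realize w := by
  classical
  have hN : N ⊨ φ.exClosure := by
    rw [Formula.realize_exClosure]
    refine ⟨fun a => a, ?_⟩
    exact (BoundedFormula.realize_restrictFreeVar (φ := φ) (f := id) (v' := id) (fun _ => rfl)).2 hφ
  have hM := (elementarilyEquivalent_iff.1 h _).2 hN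
  rw [Formula.realize_exClosure] at hM
  obtain ⟨w, hw⟩ := hM
  refine ⟨fun a => if ha : a ∈ φ.freeVarFinset then w ⟨a, ha⟩ else Classical.arbitrary M, ?_⟩
  rwa [Formula.Realize, BoundedFormula.realize_restrictFreeVar] at hw
  simp

theorem FirstOrder.Language.ElementarilyEquivalent.exists_preservesFormulas
    {L : Language.{0, 0}} {M : Type u} {N : Type v} [L.Structure M] [L.Structure N] [Nonempty M]
    (h : L.ElementarilyEquivalent M N) :
    ∃ (P : Type (max u v)) (_ : L.Structure P) (f : M → P) (g : N → P),
      PreservesFormulas L f ∧ PreservesFormulas L g := by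
  classical
  let ι := Finset {φ : L.Formula N // φ.Realize id}
  have hw (s : ι) : ∃ w : N → M, ∀ φ ∈ s, φ.1.Realize w := by
    obtain ⟨w, hw⟩ := exists_realize_of_elementarilyEquivalent h
      (Formula.iInf fun φ : s => φ.1.1) (Formula.realize_iInf.2 fun φ => φ.1.2)
    exact ⟨w, fun φ hφ => Formula.realize_iInf.1 hw ⟨φ, hφ⟩⟩
  choose w hw using hw
  let l : Ultrafilter ι := Ultrafilter.of atTop
  refine ⟨(l : Filter ι).Product fun _ => M, inferInstance,
    fun m => Quotient.mk _ fun _ => m, fun n => Quotient.mk _ fun s => w s n,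
    fun φ hφ => ?_, fun φ hφ => ?_⟩
  · exact (Ultraproduct.realize_formula_cast φ fun m _ => m).2 (Eventually.of_forall fun _ => hφ)
  · refine (Ultraproduct.realize_formula_cast φ fun n s => w s n).2 ?_
    refine Ultrafilter.of_le (f := atTop) ?_
    filter_upwards [eventually_ge_atTop ({⟨φ, hφ⟩} : ι)] with s hs
    exact hw s ⟨φ, hφ⟩ (hs (Finset.mem_singleton_self _))

theorem realize_eq_of_preservesFormulas {L : Language} {M N : Type*} [L.Structure M]
    [L.Structure N] {f : M → N} (hf : PreservesFormulas L f) {n : ℕ} {s t : L.Term (Fin n)}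
    (h : ∀ v : Fin n → M, s.realize v = t.realize v) (v : Fin n → N) :
    s.realize v = t.realize v := by
  let φ : L.Sentence := ((s.equal t).relabel (Sum.inr : Fin n → Empty ⊕ Fin n)).iAlls (Fin n)
  have hM : M ⊨ φ := by
    simp only [φ, Sentence.Realize, Formula.realize_iAlls, Formula.realize_relabel,
      Formula.realize_equal]
    exact fun w => h w
  have hN := hf.realize_sentence hM
  simp only [φ, Sentence.Realize, Formula.realize_iAlls, Formula.realize_relabel,
    Formula.realize_equal] at hN
  exact hN v

/-- The ring structure on the target of a map which preserves the truth of first-order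
formulas in the language of rings. -/
@[reducible]
noncomputable def commRingOfPreservesFormulas {R P : Type*} [CommRing R] [CompatibleRing R]
    [Language.ring.Structure P] {f : R → P} (hf : PreservesFormulas Language.ring f) :
    CommRing P :=
  letI := addOfRingStructure P
  letI := mulOfRingStructure P
  letI := negOfRingStructure P
  letI := zeroOfRingStructure P
  letI := oneOfRingStructure P
  letI := compatibleRingOfRingStructure P
  have key {n : ℕ} (s t : Language.ring.Term (Fin n))
      (h : ∀ v : Fin n → R, s.realize v = t.realize v) (v : Fin n → P) :
      s.realize v = t.realize v := realize_eq_of_preservesFormulas hf h v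
  let x {n : ℕ} (i : Fin n) : Language.ring.Term (Fin n) := Term.var i
  { addOfRingStructure P, mulOfRingStructure P, negOfRingStructure P, zeroOfRingStructure P,
    oneOfRingStructure P with
    add_assoc := fun a b c => by
      have := key (x 0 + x 1 + x 2) (x 0 + (x 1 + x 2))
        (fun v => by simp [x, add_assoc]) ![a, b, c]
      simpa [x] using this
    zero_add := fun a => by
      have := key (0 + x 0) (x 0) (fun v => by simp [x]) ![a]
      simpa [x] using this
    add_zero := fun a => by
      have := key (x 0 + 0) (x 0) (fun v => by simp [x]) ![a]
      simpa [x] using this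
    add_comm := fun a b => by
      have := key (x 0 + x 1) (x 1 + x 0) (fun v => by simp [x, add_comm]) ![a, b]
      simpa [x] using this
    mul_assoc := fun a b c => by
      have := key (x 0 * x 1 * x 2) (x 0 * (x 1 * x 2))
        (fun v => by simp [x, mul_assoc]) ![a, b, c]
      simpa [x] using this
    mul_comm := fun a b => by
      have := key (x 0 * x 1) (x 1 * x 0) (fun v => by simp [x, mul_comm]) ![a, b]
      simpa [x] using this
    one_mul := fun a => by
      have := key (1 * x 0) (x 0) (fun v => by simp [x]) ![a]
      simpa [x] using this
    mul_one := fun a => by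
      have := key (x 0 * 1) (x 0) (fun v => by simp [x]) ![a]
      simpa [x] using this
    left_distrib := fun a b c => by
      have := key (x 0 * (x 1 + x 2)) (x 0 * x 1 + x 0 * x 2)
        (fun v => by simp [x, mul_add]) ![a, b, c]
      simpa [x] using this
    right_distrib := fun a b c => by
      have := key ((x 0 + x 1) * x 2) (x 0 * x 2 + x 1 * x 2)
        (fun v => by simp [x, add_mul]) ![a, b, c]
      simpa [x] using this
    zero_mul := fun a => by
      have := key (0 * x 0) 0 (fun v => by simp [x]) ![a]
      simpa [x] using this
    mul_zero := fun a => by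
      have := key (x 0 * 0) 0 (fun v => by simp [x]) ![a]
      simpa [x] using this
    neg_add_cancel := fun a => by
      have := key (-x 0 + x 0) 0 (fun v => by simp [x]) ![a]
      simpa [x] using this
    nsmul := nsmulRec
    zsmul := zsmulRec }

theorem exists_commRing_of_preservesFormulas {R P : Type*} [CommRing R] [CompatibleRing R]
    [I : Language.ring.Structure P] {f : R → P} (hf : PreservesFormulas Language.ring f) :
    ∃ (_ : CommRing P) (c : CompatibleRing P), c.toStructure = I :=
  ⟨commRingOfPreservesFormulas hf, compatibleRingOfRingStructure P, rfl⟩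

/-- The formula expressing that every zero of the linear form with coefficients `a` is a
linear combination of the vectors `b p`. -/
noncomputable def linearSyzygyFormula {R : Type*} {l k : ℕ} (a : Fin l → R) (b : Fin k → Fin l → R) :
    Language.ring.Formula R :=
  (((termOfFreeCommRing (∑ i, FreeCommRing.of (.inl (a i)) * FreeCommRing.of (.inr i))).equal
      0).imp
    ((Formula.iInf fun i : Fin l => (Term.var (Sum.inl (Sum.inr i))).equal
      (termOfFreeCommRing (∑ p, FreeCommRing.of (.inl (.inl (b p i))) *
        FreeCommRing.of (.inr p)))).iExs (Fin k)) :
    Language.ring.Formula (R ⊕ Fin l)).iAlls (Fin l)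

theorem realize_linearSyzygyFormula {R U : Type*} [CommRing U] [CompatibleRing U] {l k : ℕ} (a : Fin l → R) (b : Fin k → Fin l → R)
    (f : R → U) : (linearSyzygyFormula a b).Realize f ↔ ∀ x : Fin l → U,
      ∑ i, f (a i) * x i = 0 → ∃ y : Fin k → U, ∀ i, x i = ∑ p, f (b p i) * y p := by
  simp [linearSyzygyFormula, Formula.realize_iAlls, Formula.realize_iExs]

/-- The formula expressing that the units are the elements which are not linear combinations of
the `a p`. -/
noncomputable def isUnitIffFormula {R : Type*} {k : ℕ} (a : Fin k → R) : Language.ring.Formula R :=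
  (Formula.iff
    (((Term.var (Sum.inl (Sum.inr ())) * Term.var (Sum.inr ()) :
      Language.ring.Term ((R ⊕ Unit) ⊕ Unit)).equal 1).iExs Unit)
    (((Term.var (.inl (.inr ()))).equal (termOfFreeCommRing (∑ p,
      FreeCommRing.of (.inl (.inl (a p))) * FreeCommRing.of (.inr p)))).iExs (Fin k)).not :
    Language.ring.Formula (R ⊕ Unit)).iAlls Unit

theorem realize_isUnitIffFormula {R U : Type*} [CommRing U] [CompatibleRing U] {k : ℕ} (a : Fin k → R) (f : R → U) :
    (isUnitIffFormula a).Realize f ↔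
      ∀ x : U, IsUnit x ↔ ¬∃ y : Fin k → U, x = ∑ p, f (a p) * y p := by
  have hu (x : U) : IsUnit x ↔ ∃ i : Unit → U, x * i () = 1 :=
    isUnit_iff_exists_inv.trans ⟨fun ⟨b, h⟩ => ⟨fun _ => b, h⟩, fun ⟨i, h⟩ => ⟨i (), h⟩⟩
  simp only [isUnitIffFormula, Formula.realize_iAlls, hu]
  refine ⟨fun h x => ?_, fun h i => ?_⟩
  · simpa [Formula.realize_iExs] using h fun _ => x
  · simpa [Formula.realize_iExs] using h (i ())

variable {R U : Type*} [CommRing R] [CommRing U] [CompatibleRing R] [CompatibleRing U]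

/-- A map preserving formulas in the language of rings is a ring homomorphism. -/
def PreservesFormulas.toRingHom {f : R → U} (hf : PreservesFormulas Language.ring f) :
    R →+* U where
  toFun := f
  map_one' := by
    simpa using hf ((1 : Language.ring.Term R).equal (Term.var 1)) (by simp) |>.symm
  map_zero' := by
    simpa using hf ((0 : Language.ring.Term R).equal (Term.var 0)) (by simp) |>.symm
  map_add' a b := by
    have := hf ((Term.var (a + b)).equal (Term.var a + Term.var b)) (by simp)
    simpa using this
  map_mul' a b := by
    have := hf ((Term.var (a * b)).equal (Term.var a * Term.var b)) (by simp)
    simpa using this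

theorem PreservesFormulas.flat [IsNoetherianRing R] {f : R → U}
    (hf : PreservesFormulas Language.ring f) : hf.toRingHom.Flat := by
  let _ := hf.toRingHom.toAlgebra
  refine Module.Flat.of_forall_isTrivialRelation fun {l a x} h => ?_
  obtain ⟨k, b, hb⟩ := Submodule.fg_iff_exists_fin_generating_family.1
    (IsNoetherian.noetherian (LinearMap.ker (Fintype.linearCombination R a)))
  have mem (z : Fin l → R) : z ∈ Submodule.span R (Set.range b) ↔ ∑ i, a i * z i = 0 := by
    simp [hb, Fintype.linearCombination_apply, mul_comm]
  have := (realize_linearSyzygyFormula a b f).1 (hf _ <|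
    (realize_linearSyzygyFormula a b id).2 fun z hz => ?_) x
    (by simpa [Algebra.smul_def, RingHom.algebraMap_toAlgebra, PreservesFormulas.toRingHom] using h)
  · obtain ⟨y, hy⟩ := this
    refine ⟨k, fun i p => b p i, y, fun i => hy i, fun p => ?_⟩
    exact (mem _).1 (Submodule.subset_span ⟨p, rfl⟩)
  · obtain ⟨y, hy⟩ := (Submodule.mem_span_range_iff_exists_fun R).1 ((mem z).2 hz)
    exact ⟨y, fun i => by simp [← hy, mul_comm]⟩

theorem PreservesFormulas.isUnit_iff [IsNoetherianRing R] [IsLocalRing R] {f : R → U}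
    (hf : PreservesFormulas Language.ring f) (x : U) :
    IsUnit x ↔ x ∉ (maximalIdeal R).map hf.toRingHom := by
  obtain ⟨k, a, ha⟩ := Submodule.fg_iff_exists_fin_generating_family.1
    (IsNoetherian.noetherian (maximalIdeal R))
  have hm : (maximalIdeal R).map hf.toRingHom = Ideal.span (Set.range fun p => f (a p)) := by
    rw [← ha, ← Ideal.span, Ideal.map_span, ← Set.range_comp]
    rfl
  rw [(realize_isUnitIffFormula a f).1 (hf _ <| (realize_isUnitIffFormula a id).2 fun z => ?_) x,
    hm, Ideal.span, Submodule.mem_span_range_iff_exists_fun]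
  · simp [mul_comm, eq_comm]
  · have := mem_maximalIdeal z
    rw [← ha, Submodule.mem_span_range_iff_exists_fun, mem_nonunits_iff] at this
    rw [← not_iff_not, ← this]
    simp [mul_comm, eq_comm]

theorem PreservesFormulas.isLocalRing [IsNoetherianRing R] [IsLocalRing R] {f : R → U}
    (hf : PreservesFormulas Language.ring f) : IsLocalRing U := by
  have : Nontrivial U := by
    refine ⟨⟨0, 1, fun h => ?_⟩⟩
    have := (hf.isUnit_iff 0).1 (h ▸ isUnit_one)
    exact this (zero_mem _)
  refine .of_nonunits_add fun a b ha hb => ?_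
  simp only [mem_nonunits_iff, hf.isUnit_iff, not_not] at *
  exact add_mem ha hb

theorem PreservesFormulas.map_maximalIdeal [IsNoetherianRing R] [IsLocalRing R] [IsLocalRing U]
    {f : R → U} (hf : PreservesFormulas Language.ring f) :
    (maximalIdeal R).map hf.toRingHom = maximalIdeal U := by
  ext x
  rw [mem_maximalIdeal, mem_nonunits_iff, hf.isUnit_iff, not_not]

end ModelTheory

section Noetherian

open MvPolynomial

theorem MvPolynomial.IsHomogeneous.homogeneousComponent_mul {σ R : Type*} [CommSemiring R]
    {F : MvPolynomial σ R} {e : ℕ} (hF : F.IsHomogeneous e) (P : MvPolynomial σ R) (d : ℕ) :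
    homogeneousComponent d (P * F) =
      (if e ≤ d then homogeneousComponent (d - e) P else 0) * F := by
  let _ := MvPolynomial.gradedAlgebra (σ := σ) (R := R)
  have key (Q : MvPolynomial σ R) (i : ℕ) :
      (DirectSum.decompose (homogeneousSubmodule σ R) Q i : MvPolynomial σ R) =
        homogeneousComponent i Q := decomposition.decompose'_apply Q i
  have := DirectSum.coe_decompose_mul_of_right_mem (homogeneousSubmodule σ R) d (a := P)
    ((mem_homogeneousSubmodule e F).2 hF)
  rw [key, key] at this
  rw [this, ite_mul, zero_mul]

theorem MvPolynomial.IsHomogeneous.eval_mem_pow_succ {σ B : Type*} [CommRing B] {x : σ → B}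
    {E : MvPolynomial σ B} {d : ℕ} (hE : E.IsHomogeneous d)
    (h : ∀ m, E.coeff m ∈ Ideal.span (Set.range x)) :
    eval x E ∈ Ideal.span (Set.range x) ^ (d + 1) := by
  rw [E.as_sum, map_sum]
  refine Ideal.sum_mem _ fun m hm => ?_
  rw [← mul_one (E.coeff m), ← C_mul_monomial, map_mul, eval_C, pow_succ']
  refine Ideal.mul_mem_mul (h m) ((Ideal.mem_span_pow_iff_exists_isHomogeneous x _).2
    ⟨_, isHomogeneous_monomial 1 ?_, rfl⟩)
  have := hE (mem_support_iff.1 hm)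
  rwa [show (1 : σ → ℕ) = fun _ => 1 from rfl, ← Finsupp.degree_eq_weight_one] at this

/-- Every ideal of a ring `B` with `B ⧸ I` Noetherian and `I` finitely generated has finitely many
elements generating all of its elements to first order in the `I`-adic filtration. -/
theorem exists_sub_sum_mem_pow_succ {σ B : Type*} [Finite σ] [CommRing B] (x : σ → B)
    [IsNoetherianRing (B ⧸ Ideal.span (Set.range x))] (J : Ideal B) :
    ∃ (k D : ℕ) (g : Fin k → B), (∀ p, g p ∈ J) ∧ ∀ d, ∀ y ∈ J,
      y ∈ Ideal.span (Set.range x) ^ d → ∃ c : Fin k → B,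
        (∀ p, c p ∈ Ideal.span (Set.range x) ^ (d - D)) ∧
          y - ∑ p, c p * g p ∈ Ideal.span (Set.range x) ^ (d + 1) := by
  set I := Ideal.span (Set.range x)
  let π : MvPolynomial σ B →+* MvPolynomial σ (B ⧸ I) := map (Ideal.Quotient.mk I)
  have hπ : Function.Surjective π := map_surjective _ Ideal.Quotient.mk_surjective
  let s : Set (MvPolynomial σ (B ⧸ I)) :=
    {G | ∃ d F, F.IsHomogeneous d ∧ π F = G ∧ ∃ g ∈ J, eval x F - g ∈ I ^ (d + 1)}
  obtain ⟨t, hts, ht⟩ := (Submodule.fg_span_iff_fg_span_finset_subset (R := MvPolynomial σ (B ⧸ I))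
    s).1 (IsNoetherian.noetherian _)
  obtain ⟨k, G, hG⟩ : ∃ (k : ℕ) (G : Fin k → MvPolynomial σ (B ⧸ I)), Set.range G = t :=
    ⟨t.card, Subtype.val ∘ t.equivFin.symm, by
      rw [t.equivFin.symm.surjective.range_comp]
      exact Subtype.range_coe⟩
  rw [← hG] at hts ht
  choose e F hF hFG g hg hFg using fun p => hts (Set.mem_range_self p)
  refine ⟨k, Finset.univ.sup e, g, hg, fun d y hyJ hyd => ?_⟩
  obtain ⟨Y, hY, rfl⟩ := (Ideal.mem_span_pow_iff_exists_isHomogeneous x y).1 hyd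
  have hYs : π Y ∈ Submodule.span (MvPolynomial σ (B ⧸ I)) s :=
    Submodule.subset_span ⟨d, Y, hY, rfl, _, hyJ, by simp⟩
  rw [ht, Submodule.mem_span_range_iff_exists_fun] at hYs
  obtain ⟨q, hq⟩ := hYs
  choose Q hQ using fun p => hπ (q p)
  let H (p : Fin k) : MvPolynomial σ B :=
    if e p ≤ d then homogeneousComponent (d - e p) (Q p) else 0
  have hH (p : Fin k) : eval x (H p) ∈ I ^ (d - e p) := by
    refine (Ideal.mem_span_pow_iff_exists_isHomogeneous x _).2 ⟨H p, ?_, rfl⟩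
    simp only [H]
    split_ifs
    exacts [homogeneousComponent_isHomogeneous _ _, isHomogeneous_zero _ _ _]
  have hE : homogeneousComponent d (Y - ∑ p, Q p * F p) = Y - ∑ p, H p * F p := by
    simp [H, (hF _).homogeneousComponent_mul, homogeneousComponent_of_mem hY]
  have hcoeff (m : σ →₀ ℕ) : (Y - ∑ p, H p * F p).coeff m ∈ I := by
    have h0 : π (Y - ∑ p, Q p * F p) = 0 := by
      rw [map_sub, map_sum, sub_eq_zero, ← hq]
      simp [hQ, hFG]
    rw [← hE, coeff_homogeneousComponent]
    split_ifs
    · rw [← Ideal.Quotient.eq_zero_iff_mem, ← coeff_map]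
      exact congrArg (coeff m) h0
    · exact zero_mem I
  refine ⟨fun p => eval x (H p), fun p => ?_, ?_⟩
  · exact Ideal.pow_le_pow_right (by have := Finset.le_sup (f := e) (Finset.mem_univ p); omega)
      (hH p)
  · have h1 : eval x (Y - ∑ p, H p * F p) ∈ I ^ (d + 1) :=
      (hE ▸ homogeneousComponent_isHomogeneous d _ : IsHomogeneous _ d).eval_mem_pow_succ hcoeff
    have h2 : ∑ p, eval x (H p) * (eval x (F p) - g p) ∈ I ^ (d + 1) := by
      refine Ideal.sum_mem _ fun p _ => ?_
      refine Ideal.pow_le_pow_right (m := d + 1) (n := (d - e p) + (e p + 1)) (by omega) ?_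
      rw [pow_add]
      exact Ideal.mul_mem_mul (hH p) (hFg p)
    convert add_mem h1 h2 using 1
    simp [mul_sub]

theorem isNoetherianRing_of_isAdicComplete {B : Type*} [CommRing B] (I : Ideal B) (hI : I.FG)
    [IsAdicComplete I B] [IsNoetherianRing (B ⧸ I)] : IsNoetherianRing B := by
  obtain ⟨n, x, rfl⟩ := Submodule.fg_iff_exists_fin_generating_family.1 hI
  change IsAdicComplete (Ideal.span (Set.range x)) B at *
  change IsNoetherianRing (B ⧸ Ideal.span (Set.range x)) at *
  set I := Ideal.span (Set.range x)
  refine isNoetherianRing_iff_ideal_fg B |>.2 fun J => ?_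
  obtain ⟨k, D, g, hg, h⟩ := exists_sub_sum_mem_pow_succ x J
  refine Submodule.fg_iff_exists_fin_generating_family.2 ⟨k, g, le_antisymm
    (Submodule.span_le.2 (Set.range_subset_iff.2 hg)) fun y hy => ?_⟩
  choose! c hc hcg using h
  let z (d : ℕ) : B := Nat.rec y (fun d z => z - ∑ p, c d z p * g p) d
  have hz (d : ℕ) : z d ∈ J ∧ z d ∈ I ^ d := by
    induction d with
    | zero => exact ⟨hy, by simp⟩
    | succ d ih =>
      exact ⟨J.sub_mem ih.1 (Ideal.sum_mem _ fun p _ => J.mul_mem_left _ (hg p)),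
        hcg d _ ih.1 ih.2⟩
  let w (p : Fin k) (N : ℕ) : B := ∑ d ∈ Finset.range (N + D), c d (z d) p
  have hw (p : Fin k) : ∃ C, ∀ N, w p N - C ∈ I ^ N := by
    obtain ⟨C, hC⟩ := IsPrecomplete.prec' (I := I) (w p) fun {a b} hab => by
      rw [SModEq.comm, SModEq.sub_mem, smul_eq_mul, Ideal.mul_top,
        ← Finset.sum_Ico_eq_sub _ (by omega : a + D ≤ b + D)]
      refine Ideal.sum_mem _ fun d hd => ?_
      rw [Finset.mem_Ico] at hd
      exact Ideal.pow_le_pow_right (by omega) (hc d _ (hz d).1 (hz d).2 p)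
    refine ⟨C, fun N => ?_⟩
    simpa [SModEq.sub_mem] using hC N
  choose C hC using hw
  have hzw (d : ℕ) : z d = y - ∑ p, (∑ i ∈ Finset.range d, c i (z i) p) * g p := by
    induction d with
    | zero => simp [z]
    | succ d ih =>
      change z d - ∑ p, c d (z d) p * g p = _
      simp only [Finset.sum_range_succ, add_mul, Finset.sum_add_distrib]
      rw [← sub_sub, ← ih]
  rw [Submodule.mem_span_range_iff_exists_fun]
  refine ⟨C, (sub_eq_zero.1 (IsHausdorff.haus' (I := I) _ fun N => ?_)).symm⟩
  rw [SModEq.zero, smul_eq_mul, Ideal.mul_top]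
  have h1 : z (N + D) ∈ I ^ N := Ideal.pow_le_pow_right (by omega) (hz _).2
  have h2 : ∑ p, (w p N - C p) * g p ∈ I ^ N :=
    Ideal.sum_mem _ fun p _ => Ideal.mul_mem_right _ _ (hC p N)
  convert add_mem h1 h2 using 1
  rw [hzw]
  simp [w, sub_mul]

end Noetherian

section Flat


/-- Approximate linear syzygies of the coefficients `f` in a flat extension are approximately
linear combinations of syzygies over the base ring. -/
theorem exists_sum_smul_ker_sub_mem_map_pow {R U ι : Type*} [CommRing R] [IsNoetherianRing R]
    [CommRing U] [Algebra R U] [Module.Flat R U] [Fintype ι] (I : Ideal R) (f : ι → R) (n : ℕ) :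
    ∃ m ≥ n, ∀ u : ι → U, ∑ i, f i • u i ∈ (I ^ m).map (algebraMap R U) →
      ∃ (k : ℕ) (s : Fin k → ι → R) (y : Fin k → U), (∀ p, ∑ i, f i * s p i = 0) ∧
        ∀ i, u i - ∑ p, s p i • y p ∈ (I ^ n).map (algebraMap R U) := by
  let φ := Fintype.linearCombination R f
  obtain ⟨k, hk⟩ := Ideal.exists_pow_inf_eq_pow_smul I (LinearMap.range φ)
  have hφ (a : ι → R) (ha : φ a ∈ I ^ (n + k)) : ∃ e : ι → R, φ e = φ a ∧ ∀ i, e i ∈ I ^ n := by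
    have h1 : φ a ∈ I ^ (n + k) • ⊤ ⊓ LinearMap.range φ := ⟨by simpa using ha, a, rfl⟩
    rw [hk _ (by omega), Nat.add_sub_cancel] at h1
    have h2 := Submodule.smul_mono le_rfl inf_le_right h1
    rw [LinearMap.range_eq_map, ← Submodule.map_smul''] at h2
    obtain ⟨e, he, hea⟩ := h2
    refine ⟨e, hea, fun i => ?_⟩
    have := Submodule.mem_map_of_mem (f := LinearMap.proj (φ := fun _ => R) i) he
    rw [Submodule.map_smul''] at this
    simpa using Submodule.smul_mono (le_refl (I ^ n)) le_top this
  refine ⟨n + k, by omega, fun u hu => ?_⟩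
  obtain ⟨q, w, hw⟩ := Submodule.fg_iff_exists_fin_generating_family.1
    (IsNoetherian.noetherian (I ^ (n + k)))
  rw [← hw, ← Ideal.span, Ideal.map_span, ← Set.range_comp, Ideal.span,
    Submodule.mem_span_range_iff_exists_fun] at hu
  obtain ⟨z, hz⟩ := hu
  have hrel : ∑ i, Sum.elim f (-w) i • Sum.elim u z i = 0 := by
    have : ∑ i, f i • u i = ∑ j, w j • z j := by
      rw [← hz]
      simp [Algebra.smul_def, mul_comm]
    simp [this]
  obtain ⟨κ, a, y, hay, ha⟩ := Module.Flat.isTrivialRelation_of_sum_smul_eq_zero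
    (R := R) (M := U) hrel
  have hker (p) : φ (fun i => a (.inl i) p) = ∑ j, w j * a (.inr j) p := by
    have := ha p
    simp only [Fintype.sum_sum_type, Sum.elim_inl, Sum.elim_inr, Pi.neg_apply, neg_mul,
      Finset.sum_neg_distrib, ← sub_eq_add_neg, sub_eq_zero] at this
    simpa [φ, Fintype.linearCombination_apply, mul_comm] using this
  have hmem (p) : φ (fun i => a (.inl i) p) ∈ I ^ (n + k) := by
    rw [hker]
    exact Ideal.sum_mem _ fun j _ => Ideal.mul_mem_right _ _
      (hw ▸ Submodule.subset_span ⟨j, rfl⟩)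
  choose e he hei using fun p => hφ _ (hmem p)
  refine ⟨_, fun p i => a (.inl i) p - e p i, y, fun p => ?_, fun i => ?_⟩
  · have := sub_eq_zero.2 (he p).symm
    simpa [φ, Fintype.linearCombination_apply, mul_sub, mul_comm] using this
  · have : u i - ∑ p, (a (.inl i) p - e p i) • y p = ∑ p, e p i • y p := by
      rw [sub_eq_iff_eq_add, ← Finset.sum_add_distrib]
      simpa [← add_smul] using hay (.inl i)
    rw [this]
    refine Ideal.sum_mem _ fun p _ => ?_
    rw [Algebra.smul_def]
    exact Ideal.mul_mem_right _ _ (Ideal.mem_map_of_mem _ (hei p i))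

theorem flat_of_dense {R U T : Type*} [CommRing R] [IsNoetherianRing R] [CommRing U] [CommRing T]
    [IsNoetherianRing T] [IsLocalRing T] [Algebra R U] [Algebra U T] [Algebra R T]
    [IsScalarTower R U T] [Module.Flat R U] (I : Ideal R)
    (hI : I.map (algebraMap R T) ≠ ⊤)
    (surj : ∀ n (t : T), ∃ u : U, t - algebraMap U T u ∈ (I ^ n).map (algebraMap R T))
    (inj : ∀ n (u : U), algebraMap U T u ∈ (I ^ n).map (algebraMap R T) →
      u ∈ (I ^ n).map (algebraMap R U)) :
    Module.Flat R T := by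
  refine Module.Flat.of_forall_isTrivialRelation fun {l f x} h => ?_
  let S : Set (Fin l → T) :=
    Set.image (fun (s : Fin l → R) i => algebraMap R T (s i)) {s | ∑ i, f i * s i = 0}
  let N : Submodule T (Fin l → T) := Submodule.span T S
  have hx : x ∈ N := by
    rw [← Submodule.Quotient.mk_eq_zero, ← Submodule.mem_bot T,
      ← Ideal.iInf_pow_smul_eq_bot_of_isLocalRing _ hI, Submodule.mem_iInf]
    intro n
    obtain ⟨m, hmn, hm⟩ := exists_sum_smul_ker_sub_mem_map_pow (U := U) I f n
    choose u hu using fun i => surj m (x i)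
    obtain ⟨k, s, y, hs, hy⟩ := hm u <| inj _ _ <| by
      have : algebraMap U T (∑ i, f i • u i) = -∑ i, f i • (x i - algebraMap U T (u i)) := by
        simp [smul_sub, h, Algebra.algebraMap_eq_smul_one]
      rw [this]
      exact neg_mem (Ideal.sum_mem _ fun i _ => Submodule.smul_of_tower_mem _ _ (hu i))
    let v : Fin l → T := ∑ p, algebraMap U T (y p) • fun i => algebraMap R T (s p i)
    have hv : v ∈ N := Submodule.sum_mem _ fun p _ => Submodule.smul_mem _ _
      (Submodule.subset_span ⟨s p, hs p, rfl⟩)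
    have hxv (i : Fin l) : (x - v) i ∈ (I.map (algebraMap R T)) ^ n := by
      rw [← Ideal.map_pow]
      have h1 := Ideal.map_mono (f := algebraMap R T) (Ideal.pow_le_pow_right hmn) (hu i)
      have h2 := Ideal.mem_map_of_mem (algebraMap U T) (hy i)
      rw [Ideal.map_map, ← IsScalarTower.algebraMap_eq] at h2
      convert add_mem h1 h2 using 1
      simp [v, Algebra.smul_def, mul_comm, ← IsScalarTower.algebraMap_apply]
    rw [← sub_zero (Submodule.Quotient.mk x), ← (Submodule.Quotient.mk_eq_zero N).2 hv,
      ← Submodule.Quotient.mk_sub, ← Submodule.mkQ_apply, pi_eq_sum_univ' (x - v), map_sum]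
    refine Submodule.sum_mem _ fun i _ => ?_
    rw [map_smul]
    exact Submodule.smul_mem_smul (hxv i) trivial
  obtain ⟨k, y, s, hys⟩ := Submodule.mem_span_set'.1 hx
  choose b hb hbs using fun p => (s p).2
  refine ⟨k, fun i p => b p i, y, fun i => ?_, hb⟩
  simp [← hys, ← hbs, Algebra.smul_def, mul_comm]

end Flat

section Completion

variable {U : Type*} [CommRing U]

theorem AdicCompletion.mem_map_pow_iff {I : Ideal U} (fg : I.FG) (n : ℕ)
    (t : AdicCompletion I U) :
    t ∈ (I ^ n).map (algebraMap U (AdicCompletion I U)) ↔ eval I U n t = 0 := by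
  rw [← LinearMap.mem_ker, ← pow_smul_top_eq_ker_eval fg, Ideal.smul_top_eq_map]
  rfl

theorem AdicCompletion.exists_sub_algebraMap_mem_map_pow {I : Ideal U} (fg : I.FG) (n : ℕ)
    (t : AdicCompletion I U) :
    ∃ u : U, t - algebraMap U _ u ∈ (I ^ n).map (algebraMap U (AdicCompletion I U)) := by
  obtain ⟨u, hu⟩ := Submodule.mkQ_surjective _ (eval I U n t)
  refine ⟨u, (mem_map_pow_iff fg n _).2 ?_⟩
  rw [map_sub, ← hu, AdicCompletion.algebraMap_apply, sub_eq_zero]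
  rfl

theorem AdicCompletion.mem_pow_of_algebraMap_mem_map_pow {I : Ideal U} (fg : I.FG) (n : ℕ) (u : U)
    (h : algebraMap U _ u ∈ (I ^ n).map (algebraMap U (AdicCompletion I U))) : u ∈ I ^ n := by
  rw [mem_map_pow_iff fg, AdicCompletion.algebraMap_apply] at h
  simpa using (Submodule.Quotient.mk_eq_zero (I ^ n • ⊤ : Submodule U U)).1 h

theorem AdicCompletion.isNoetherianRing_of_fg [IsLocalRing U] (fg : (maximalIdeal U).FG) :
    IsNoetherianRing (AdicCompletion (maximalIdeal U) U) := by
  have := isLocalRing_of_fg fg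
  have := isAdicComplete_of_fg fg
  let _ := Ideal.Quotient.field (maximalIdeal (AdicCompletion (maximalIdeal U) U))
  refine isNoetherianRing_of_isAdicComplete (maximalIdeal _) ?_
  rw [maximalIdeal_eq_map_of_fg fg]
  exact fg.map _

theorem isScalarExtension_of_dense {R T : Type*} [CommRing R] [CommRing T] [IsNoetherianRing R]
    [IsNoetherianRing T] [IsLocalRing R] [IsLocalRing U] [IsLocalRing T] {φ : R →+* U}
    {ψ : U →+* T} (hφ : φ.Flat) (hm : (maximalIdeal R).map φ = maximalIdeal U)
    (hψ : (maximalIdeal U).map ψ = maximalIdeal T)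
    (surj : ∀ n (t : T), ∃ u : U, t - ψ u ∈ (maximalIdeal U ^ n).map ψ)
    (inj : ∀ n (u : U), ψ u ∈ (maximalIdeal U ^ n).map ψ → u ∈ maximalIdeal U ^ n) :
    ∃ _ : IsLocalHom (ψ.comp φ), IsScalarExtension (ψ.comp φ) := by
  let _ : Algebra R U := φ.toAlgebra
  let _ : Algebra U T := ψ.toAlgebra
  let _ : Algebra R T := (ψ.comp φ).toAlgebra
  have : IsScalarTower R U T := .of_algebraMap_eq fun _ => rfl
  have : Module.Flat R U := hφ
  have hmap (n : ℕ) : (maximalIdeal R ^ n).map (algebraMap R T) = (maximalIdeal U ^ n).map ψ := by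
    rw [← hm, ← Ideal.map_pow, Ideal.map_map]
    rfl
  have hmT : (maximalIdeal R).map (algebraMap R T) = maximalIdeal T := by
    simpa [hψ] using hmap 1
  have : Module.Flat R T := by
    refine flat_of_dense (U := U) (maximalIdeal R) (hmT ▸ Ideal.IsPrime.ne_top') ?_ ?_
    · simp only [hmap]
      exact surj
    · intro n u hu
      rw [hmap] at hu
      rw [Ideal.map_pow]
      exact hm ▸ inj n u hu
  have hloc : IsLocalHom (algebraMap R T) :=
    ((local_hom_TFAE (algebraMap R T)).out 0 2).2 hmT.le
  exact ⟨hloc, Module.FaithfullyFlat.of_flat_of_isLocalHom, hmT⟩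

theorem isScalarExtension_adicCompletion {R : Type*} [CommRing R] [IsNoetherianRing R]
    [IsLocalRing R] [IsLocalRing U] {φ : R →+* U} (hφ : φ.Flat)
    (hm : (maximalIdeal R).map φ = maximalIdeal U)
    [IsLocalRing (AdicCompletion (maximalIdeal U) U)] :
    ∃ _ : IsLocalHom ((algebraMap U (AdicCompletion (maximalIdeal U) U)).comp φ),
      IsScalarExtension ((algebraMap U (AdicCompletion (maximalIdeal U) U)).comp φ) :=
  have fg : (maximalIdeal U).FG := hm ▸ (maximalIdeal R).fg_of_isNoetherianRing.map φ
  have := AdicCompletion.isNoetherianRing_of_fg fg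
  isScalarExtension_of_dense hφ hm (AdicCompletion.maximalIdeal_eq_map_of_fg fg).symm
    (AdicCompletion.exists_sub_algebraMap_mem_map_pow fg)
    (AdicCompletion.mem_pow_of_algebraMap_mem_map_pow fg)

end Completion

/-- Noetherian local rings which are elementarily equivalent in the first-order
language of rings are similar. -/
theorem elementarilyEquivalent_areSimilar
    {R : Type u} {S : Type v} [CommRing R] [CommRing S]
    [IsNoetherianRing R] [IsNoetherianRing S] [IsLocalRing R] [IsLocalRing S]
    (h : letI := FirstOrder.Ring.compatibleRingOfRing R
         letI := FirstOrder.Ring.compatibleRingOfRing S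
         FirstOrder.Language.ring.ElementarilyEquivalent R S) :
    AreSimilar R S := by
  let _ := FirstOrder.Ring.compatibleRingOfRing R
  let _ := FirstOrder.Ring.compatibleRingOfRing S
  obtain ⟨U, _, f, g, hf, hg⟩ := h.exists_preservesFormulas
  obtain ⟨_, _, rfl⟩ := exists_commRing_of_preservesFormulas hf
  have := hf.isLocalRing
  have fg : (maximalIdeal U).FG :=
    hf.map_maximalIdeal ▸ (maximalIdeal R).fg_of_isNoetherianRing.map _
  have := AdicCompletion.isLocalRing_of_fg fg
  obtain ⟨hf₁, hf₂⟩ := isScalarExtension_adicCompletion hf.flat hf.map_maximalIdeal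
  obtain ⟨hg₁, hg₂⟩ := isScalarExtension_adicCompletion hg.flat hg.map_maximalIdeal
  exact ⟨_, inferInstance, AdicCompletion.isNoetherianRing_of_fg fg, inferInstance, _, _, hf₁, hg₁,
    hf₂, hg₂⟩
end

section
/- Let R and S be Noetherian local rings such that for every n ≥ 1 there is a ring isomorphism R/m_R^n ≅ S/m_S^n between their n-th infinitesimal neighborhoods. Then R and S are similar. -/
open IsLocalRing

universe u v

open Filter Polynomial

/-- If an ideal `I` is finitely generated, `A ⧸ I` is Noetherian, and all finitely generated ideals
are closed in the `I`-adic topology, then `A` is Noetherian. -/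
theorem isNoetherianRing_of_fg_closed {A : Type*} [CommRing A] (I : Ideal A) (hI : I.FG)
    [IsNoetherianRing (A ⧸ I)]
    (hcl : ∀ J : Ideal A, J.FG → ∀ t, (∀ k, t ∈ J ⊔ I ^ k) → t ∈ J) :
    IsNoetherianRing A := by
  let Q := reesAlgebra I ⧸ I.map (algebraMap A (reesAlgebra I))
  have : Algebra.FiniteType A (reesAlgebra I) :=
    ⟨(reesAlgebra I).fg_top.mpr (reesAlgebra.fg hI)⟩
  have : Algebra.FiniteType A Q :=
    .of_surjective (Ideal.Quotient.mkₐ A _) (Ideal.Quotient.mkₐ_surjective A _)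
  have : Algebra.FiniteType (A ⧸ I) Q := .of_restrictScalars_finiteType A _ _
  have : IsNoetherianRing Q := Algebra.FiniteType.isNoetherianRing (A ⧸ I) Q
  -- the ideal of leading forms
  let L : Ideal A → Ideal Q := fun J ↦
    ((J.map C).comap (algebraMap (reesAlgebra I) A[X])).map (Ideal.Quotient.mk _)
  have hLmono : Monotone L := fun J J' h ↦
    Ideal.map_mono (Ideal.comap_mono (Ideal.map_mono h))
  have hcoeff : ∀ f ∈ I.map (algebraMap A (reesAlgebra I)), ∀ k,
      (f : A[X]).coeff k ∈ I ^ (k + 1) := by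
    intro f hf k
    refine Submodule.span_induction 
      (p := fun (f : reesAlgebra I) _ ↦ ∀ k, (f : A[X]).coeff k ∈ I ^ (k + 1))
      ?_ ?_ ?_ ?_ hf k
    · rintro _ ⟨r, hr, rfl⟩ k
      change (C r).coeff k ∈ _
      rw [coeff_C]
      split_ifs with h0 <;> simp_all
    · simp
    · intro x y _ _ hx hy k
      simpa using add_mem (hx k) (hy k)
    · intro a x _ hx k
      change ((a : A[X]) * (x : A[X])).coeff k ∈ _
      rw [coeff_mul]
      refine sum_mem fun ij hij ↦ ?_
      rw [← Finset.HasAntidiagonal.mem_antidiagonal.mp hij, add_assoc, pow_add]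
      exact Ideal.mul_mem_mul (a.2 _) (hx _)
  have key : ∀ J₀ J : Ideal A, L J ≤ L J₀ → ∀ k, ∀ t ∈ J, t ∈ I ^ k → t ∈ J₀ ⊔ I ^ (k + 1) := by
    intro J₀ J hL k t htJ htk
    let p : reesAlgebra I := ⟨monomial k t, reesAlgebra.monomial_mem.mpr htk⟩
    have hp : Ideal.Quotient.mk _ p ∈ L J := by
      refine Ideal.mem_map_of_mem _ ?_
      rw [Ideal.mem_comap, Ideal.mem_map_C_iff]
      intro n
      change (monomial k t).coeff n ∈ J
      rw [coeff_monomial]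
      split_ifs <;> simp [htJ]
    obtain ⟨q, hq, hqp⟩ := (Ideal.mem_map_iff_of_surjective _ Ideal.Quotient.mk_surjective).mp
      (hL hp)
    rw [Ideal.mem_comap, Ideal.mem_map_C_iff] at hq
    have h1 := hcoeff _ (Ideal.Quotient.eq.mp hqp.symm) k
    have h2 := hq k
    have h3 : t = (q : A[X]).coeff k + ((p - q : reesAlgebra I) : A[X]).coeff k := by
      simp [p]
    rw [h3]
    exact Submodule.add_mem_sup h2 h1
  rw [isNoetherianRing_iff_ideal_fg]
  intro J
  obtain ⟨_, ⟨J₀, ⟨hJ₀J, hJ₀⟩, rfl⟩, hmax⟩ :=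
    set_has_maximal_iff_noetherian.mpr (inferInstanceAs (IsNoetherian Q Q))
      (L '' {J₀ | J₀ ≤ J ∧ J₀.FG}) ⟨_, ⊥, ⟨bot_le, Submodule.fg_bot⟩, rfl⟩
  suffices J ≤ J₀ by rwa [← le_antisymm hJ₀J this]
  have hstep : ∀ k, ∀ t ∈ J, t ∈ I ^ k → t ∈ J₀ ⊔ I ^ (k + 1) := by
    intro k t htJ htk
    let J₁ := J₀ ⊔ Ideal.span {t}
    have hJ₁J : J₁ ≤ J := sup_le hJ₀J ((Ideal.span_singleton_le_iff_mem _).mpr htJ)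
    have hJ₁ : J₁.FG := Submodule.FG.sup hJ₀ (Submodule.fg_span_singleton t)
    have hL : L J₁ ≤ L J₀ := by
      rw [eq_of_le_of_not_lt (hLmono le_sup_left) (hmax (L J₁) ⟨J₁, ⟨hJ₁J, hJ₁⟩, rfl⟩)]
    exact key J₀ J₁ hL k t (Ideal.mem_sup_right (Ideal.mem_span_singleton_self t)) htk
  intro t ht
  refine hcl J₀ hJ₀ t fun k ↦ ?_
  induction k with
  | zero => simp
  | succ k ih =>
    obtain ⟨a, ha, b, hb, rfl⟩ := Submodule.mem_sup.mp ih
    have hbJ : b ∈ J := by simpa using J.sub_mem ht (hJ₀J ha)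
    exact add_mem (Ideal.mem_sup_left ha) (hstep k b hbJ hb)

/-- A form of the Artin–Rees lemma for a linear form on a finite free module. -/
theorem exists_artinRees_linearMap {R : Type*} [CommRing R] [IsNoetherianRing R] (I : Ideal R)
    {l : ℕ} (φ : (Fin l → R) →ₗ[R] R) :
    ∃ c, ∀ n x, φ x ∈ I ^ (n + c) → ∃ z, (∀ i, z i ∈ I ^ n) ∧ φ z = φ x := by
  obtain ⟨c, hc⟩ := Ideal.exists_pow_inf_eq_pow_smul I (LinearMap.range φ)
  refine ⟨c, fun n x hx ↦ ?_⟩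
  have h1 : φ x ∈ I ^ (n + c) • (⊤ : Submodule R R) ⊓ LinearMap.range φ :=
    ⟨by simpa using hx, x, rfl⟩
  rw [hc _ (by lia), Nat.add_sub_cancel] at h1
  have h2 : φ x ∈ I ^ n • LinearMap.range φ := Submodule.smul_mono le_rfl inf_le_right h1
  rw [LinearMap.range_eq_map, ← Submodule.map_smul''] at h2
  obtain ⟨z, hz, hzx⟩ := h2
  refine ⟨z, fun i ↦ ?_, hzx⟩
  have := Submodule.mem_map_of_mem (f := LinearMap.proj (R := R) (φ := fun _ ↦ R) i) hz
  rw [Submodule.map_smul''] at this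
  exact Ideal.mul_le_left this

/-- Countable saturation: a sequence of properties each of which holds eventually along `F` has
a diagonal choice. -/
theorem exists_tendsto_diagonal {ι : Type*} {F : Filter ι} {N : ι → ℕ} (hN : Tendsto N F atTop)
    (P : ι → ℕ → Prop) (h0 : ∀ n, P n 0) (hP : ∀ k, ∀ᶠ n in F, P n k) :
    ∃ κ : ι → ℕ, (∀ n, P n (κ n)) ∧ Tendsto κ F atTop := by
  classical
  refine ⟨fun n ↦ Nat.findGreatest (P n) (N n), fun n ↦ ?_, ?_⟩
  · exact Nat.findGreatest_spec (Nat.zero_le _) (h0 n)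
  · rw [tendsto_atTop]
    intro k
    filter_upwards [hP k, hN.eventually_ge_atTop k] with n h1 h2
    exact Nat.le_findGreatest h2 h1

/-- `π` presents `T` as the cataproduct of `R` along `U`, i.e. the quotient of the
ultrapower of `R` by its ideal of infinitesimals. -/
structure IsCataproduct {ι R T : Type*} [CommRing R] [IsLocalRing R] [CommRing T]
    (U : Ultrafilter ι) (π : (ι → R) →+* T) : Prop where
  surjective : Function.Surjective π
  eq_zero_iff : ∀ x, π x = 0 ↔ ∀ k, ∀ᶠ n in (U : Filter ι), x n ∈ maximalIdeal R ^ k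

namespace IsCataproduct

variable {ι R T : Type*} [CommRing R] [IsLocalRing R] [CommRing T]
  {U : Ultrafilter ι} {π : (ι → R) →+* T}

theorem eq_of_eventuallyEq (h : IsCataproduct U π) {x y : ι → R}
    (hxy : ∀ᶠ n in (U : Filter ι), x n = y n) : π x = π y := by
  rw [← sub_eq_zero, ← map_sub, h.eq_zero_iff]
  intro k
  filter_upwards [hxy] with n hn
  simp [hn]

theorem eventually_mem_of_mem_map (h : IsCataproduct U π) {k : ℕ} {x : ι → R}
    (hx : π x ∈ (maximalIdeal R ^ k).map (π.comp (Pi.constRingHom ι R))) :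
    ∀ᶠ n in (U : Filter ι), x n ∈ maximalIdeal R ^ k := by
  rw [← Ideal.map_map, Ideal.mem_map_iff_of_surjective _ h.surjective] at hx
  obtain ⟨y, hy, hyx⟩ := hx
  have hyn : ∀ n, y n ∈ maximalIdeal R ^ k := fun n ↦ by
    have := Ideal.mem_map_of_mem (Pi.evalRingHom (fun _ : ι ↦ R) n) hy
    rw [Ideal.map_map] at this
    have e : (Pi.evalRingHom (fun _ : ι ↦ R) n).comp (Pi.constRingHom ι R) = RingHom.id R := rfl
    rwa [e, Ideal.map_id] at this
  have := (h.eq_zero_iff (x - y)).mp (by rw [map_sub, hyx, sub_self]) k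
  filter_upwards [this] with n hn
  simpa using add_mem hn (hyn n)

theorem mem_map_of_eventually_mem (h : IsCataproduct U π) {I : Ideal R} (hI : I.FG) {x : ι → R}
    (hx : ∀ᶠ n in (U : Filter ι), x n ∈ I) :
    π x ∈ I.map (π.comp (Pi.constRingHom ι R)) := by
  obtain ⟨s, c, hc⟩ := Submodule.fg_iff_exists_fin_generating_family.mp hI
  have : ∀ n, ∃ a : Fin s → R, x n ∈ I → ∑ i, a i * c i = x n := fun n ↦ by
    by_cases hn : x n ∈ I
    · rw [← hc, Submodule.mem_span_range_iff_exists_fun] at hn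
      obtain ⟨a, ha⟩ := hn
      exact ⟨a, fun _ ↦ ha⟩
    · exact ⟨0, fun h ↦ absurd h hn⟩
  choose a ha using this
  have hxe : π x = π (∑ i, (fun n ↦ a n i) * Pi.constRingHom ι R (c i)) := by
    refine h.eq_of_eventuallyEq ?_
    filter_upwards [hx] with n hn
    simp [← ha n hn]
  rw [hxe, map_sum]
  refine sum_mem fun i _ ↦ ?_
  rw [map_mul]
  refine Ideal.mul_mem_left _ _ (Ideal.mem_map_of_mem (π.comp (Pi.constRingHom ι R)) ?_)
  rw [← hc]
  exact Submodule.subset_span ⟨i, rfl⟩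

theorem isUnit_of_eventually (h : IsCataproduct U π) {x : ι → R}
    (hx : ∀ᶠ n in (U : Filter ι), IsUnit (x n)) : IsUnit (π x) := by
  refine IsUnit.of_mul_eq_one (π fun n ↦ Ring.inverse (x n)) ?_
  rw [← map_mul, ← map_one π]
  refine h.eq_of_eventuallyEq ?_
  filter_upwards [hx] with n hn
  exact Ring.mul_inverse_cancel _ hn

theorem isLocalRing (h : IsCataproduct U π) : IsLocalRing T := by
  have : Nontrivial T := by
    refine ⟨1, 0, fun h1 ↦ ?_⟩
    rw [← map_one π, h.eq_zero_iff] at h1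
    obtain ⟨n, hn⟩ := (h1 1).exists
    simp at hn
  refine .of_isUnit_or_isUnit_one_sub_self fun t ↦ ?_
  obtain ⟨x, rfl⟩ := h.surjective t
  by_cases hx : ∀ᶠ n in (U : Filter ι), IsUnit (x n)
  · exact .inl (h.isUnit_of_eventually hx)
  · right
    rw [← map_one π, ← map_sub]
    refine h.isUnit_of_eventually ?_
    filter_upwards [Ultrafilter.eventually_not.mpr hx] with n hn
    exact (IsLocalRing.isUnit_or_isUnit_one_sub_self (x n)).resolve_left hn

theorem mem_of_forall_mem_sup (h : IsCataproduct U π) {N : ι → ℕ} (hN : Tendsto N U atTop)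
    {J : Ideal T} (hJ : J.FG) {t : T}
    (ht : ∀ k, t ∈ J ⊔ (maximalIdeal R ^ k).map (π.comp (Pi.constRingHom ι R))) : t ∈ J := by
  obtain ⟨s, g, rfl⟩ := Submodule.fg_iff_exists_fin_generating_family.mp hJ
  obtain ⟨x, rfl⟩ := h.surjective t
  choose G hG using fun i ↦ h.surjective (g i)
  obtain ⟨κ, hκ, hκN⟩ := exists_tendsto_diagonal hN
    (fun n k ↦ ∃ a : Fin s → R, x n - ∑ i, a i * G i n ∈ maximalIdeal R ^ k)
    (fun n ↦ ⟨0, by simp⟩) fun k ↦ by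
      obtain ⟨u, hu, v, hv, huv⟩ := Submodule.mem_sup.mp (ht k)
      obtain ⟨b, rfl⟩ := (Submodule.mem_span_range_iff_exists_fun _).mp hu
      choose B hB using fun i ↦ h.surjective (b i)
      have hv' : v = π (x - ∑ i, B i * G i) := by
        simp [hB, hG, ← huv]
      rw [hv'] at hv
      filter_upwards [h.eventually_mem_of_mem_map hv] with n hn
      exact ⟨fun i ↦ B i n, by simpa using hn⟩
  choose a ha using hκ
  have : π x = ∑ i, π (fun n ↦ a n i) • g i := by
    have h0 : π (x - ∑ i, (fun n ↦ a n i) * G i) = 0 := by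
      rw [h.eq_zero_iff]
      intro k
      filter_upwards [hκN.eventually_ge_atTop k] with n hn
      simpa using Ideal.pow_le_pow_right hn (ha n)
    rw [map_sub, sub_eq_zero] at h0
    simp [h0, hG]
  rw [this]
  exact sum_mem fun i _ ↦ Submodule.smul_mem _ _ (Submodule.subset_span ⟨i, rfl⟩)

variable [IsNoetherianRing R]

theorem map_maximalIdeal (h : IsCataproduct U π) [IsLocalRing T] :
    (maximalIdeal R).map (π.comp (Pi.constRingHom ι R)) = maximalIdeal T := by
  apply le_antisymm
  · refine le_maximalIdeal fun htop ↦ ?_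
    have h1 : π 1 ∈ (maximalIdeal R ^ 1).map (π.comp (Pi.constRingHom ι R)) := by
      rw [pow_one, htop]; trivial
    obtain ⟨n, hn⟩ := (h.eventually_mem_of_mem_map h1).exists
    simp at hn
  · intro t ht
    obtain ⟨x, rfl⟩ := h.surjective t
    refine h.mem_map_of_eventually_mem (IsNoetherian.noetherian _) ?_
    by_contra hx
    refine ht (h.isUnit_of_eventually ?_)
    filter_upwards [Ultrafilter.eventually_not.mpr hx] with n hn
    simpa using hn

theorem isNoetherianRing (h : IsCataproduct U π) {N : ι → ℕ} (hN : Tendsto N U atTop) :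
    IsNoetherianRing T := by
  have := h.isLocalRing
  have hm := h.map_maximalIdeal
  let := Ideal.Quotient.field (maximalIdeal T)
  refine isNoetherianRing_of_fg_closed (maximalIdeal T) ?_ fun J hJ t ht ↦
    h.mem_of_forall_mem_sup hN hJ fun k ↦ ?_
  · rw [← hm]
    exact Ideal.FG.map (IsNoetherian.noetherian _) _
  · rw [Ideal.map_pow, hm]
    exact ht k

theorem flat (h : IsCataproduct U π) {N : ι → ℕ} (hN : Tendsto N U atTop) :
    letI : Algebra R T := (π.comp (Pi.constRingHom ι R)).toAlgebra; Module.Flat R T := by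
  let : Algebra R T := (π.comp (Pi.constRingHom ι R)).toAlgebra
  have hsmul : ∀ (r : R) (x : ι → R), r • π x = π (r • x) := fun r x ↦ by
    rw [Algebra.smul_def]
    exact (map_mul π _ _).symm
  refine .of_forall_isTrivialRelation fun {l f x} hfx ↦ ?_
  choose X hX using fun i ↦ h.surjective (x i)
  let φ : (Fin l → R) →ₗ[R] R := Fintype.linearCombination R f
  have hφ : ∀ a, φ a = ∑ i, f i * a i := fun a ↦ by
    simp [φ, Fintype.linearCombination_apply, mul_comm]
  obtain ⟨c, hc⟩ := exists_artinRees_linearMap (maximalIdeal R) φ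
  have h0 : π (fun n ↦ φ fun i ↦ X i n) = 0 := by
    rw [← hfx]
    simp_rw [← hX, hsmul, ← map_sum]
    congr 1
    ext n
    simp [hφ]
  rw [h.eq_zero_iff] at h0
  obtain ⟨κ, hκ, hκN⟩ := exists_tendsto_diagonal hN
    (fun n k ↦ ∃ z, (∀ i, z i ∈ maximalIdeal R ^ k) ∧ φ z = φ fun i ↦ X i n)
    (fun n ↦ ⟨_, by simp, rfl⟩) fun k ↦ by
      filter_upwards [h0 (k + c)] with n hn
      exact hc k _ hn
  choose z hz hzX using hκ
  obtain ⟨s, e, he⟩ := Submodule.fg_iff_exists_fin_generating_family.mp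
    (IsNoetherian.noetherian (LinearMap.ker φ))
  have hker : ∀ n, ∃ a : Fin s → R, ∑ j, a j • e j = (fun i ↦ X i n) - z n := fun n ↦ by
    rw [← Submodule.mem_span_range_iff_exists_fun, he, LinearMap.mem_ker, map_sub, hzX, sub_self]
  choose a ha using hker
  refine ⟨s, fun i j ↦ e j i, fun j ↦ π fun n ↦ a n j, fun i ↦ ?_, fun j ↦ ?_⟩
  · simp_rw [hsmul, ← map_sum]
    rw [← hX, ← sub_eq_zero, ← map_sub, h.eq_zero_iff]
    intro k
    filter_upwards [hκN.eventually_ge_atTop k] with n hn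
    have hni := congr_fun (ha n) i
    have : (X i - ∑ j, e j i • fun n ↦ a n j) n = z n i := by
      simp only [Finset.sum_apply, Pi.smul_apply, smul_eq_mul, Pi.sub_apply] at hni ⊢
      simp_rw [mul_comm (e _ i), hni, sub_sub_cancel]
    rw [this]
    exact Ideal.pow_le_pow_right hn (hz n i)
  · rw [← hφ]
    change e j ∈ LinearMap.ker φ
    rw [← he]
    exact Submodule.subset_span ⟨j, rfl⟩

theorem isLocalHom (h : IsCataproduct U π) [IsLocalRing T] :
    IsLocalHom (π.comp (Pi.constRingHom ι R)) :=
  ((IsLocalRing.local_hom_TFAE _).out 2 0).mp h.map_maximalIdeal.le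

theorem isScalarExtension (h : IsCataproduct U π) [IsLocalRing T] {N : ι → ℕ}
    (hN : Tendsto N U atTop) : IsScalarExtension (π.comp (Pi.constRingHom ι R)) := by
  refine ⟨?_, h.map_maximalIdeal⟩
  let : Algebra R T := (π.comp (Pi.constRingHom ι R)).toAlgebra
  have := h.flat hN
  have : IsLocalHom (algebraMap R T) := h.isLocalHom
  exact Module.FaithfullyFlat.of_flat_of_isLocalHom

end IsCataproduct

/-- The ideal of infinitesimals in a product of local rings along a filter. -/
def infinitesimalIdeal {ι : Type*} (F : Filter ι) (B : ι → Type*) [∀ n, CommRing (B n)]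
    [∀ n, IsLocalRing (B n)] : Ideal (∀ n, B n) where
  carrier := {x | ∀ k, ∀ᶠ n in F, x n ∈ maximalIdeal (B n) ^ k}
  zero_mem' k := by simp
  add_mem' hx hy k := by
    filter_upwards [hx k, hy k] with n h1 h2 using add_mem h1 h2
  smul_mem' c x hx k := by
    filter_upwards [hx k] with n h1 using Ideal.mul_mem_left _ _ h1

/-- Compatible surjections `R → B n` whose kernels shrink to zero in the adic topology present
the quotient of `∏ B n` by infinitesimals as the cataproduct of `R`. -/
theorem isCataproduct_mk_infinitesimalIdeal {ι R : Type*} [CommRing R] [IsLocalRing R]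
    (U : Ultrafilter ι) {N : ι → ℕ} (hN : Tendsto N U atTop) (B : ι → Type*)
    [∀ n, CommRing (B n)] [∀ n, IsLocalRing (B n)] (f : ∀ n, R →+* B n)
    (hf : ∀ n, Function.Surjective (f n))
    (hker : ∀ n, RingHom.ker (f n) ≤ maximalIdeal R ^ N n) :
    IsCataproduct U ((Ideal.Quotient.mk (infinitesimalIdeal (U : Filter ι) B)).comp
      (RingHom.pi fun n ↦ (f n).comp (Pi.evalRingHom _ n))) where
  surjective := Ideal.Quotient.mk_surjective.comp (Function.Surjective.piMap hf)
  eq_zero_iff x := by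
    rw [RingHom.comp_apply, Ideal.Quotient.eq_zero_iff_mem]
    refine forall_congr' fun k ↦ eventually_congr ?_
    filter_upwards [hN.eventually_ge_atTop k] with n hn
    have : IsLocalHom (f n) := .of_surjective _ (hf n)
    change f n (x n) ∈ _ ↔ _
    rw [← map_maximalIdeal_of_surjective (f n) (hf n), ← Ideal.map_pow, ← Ideal.mem_comap,
      Ideal.comap_map_of_surjective' _ (hf n),
      sup_eq_left.mpr ((hker n).trans (Ideal.pow_le_pow_right hn))]

/-- if two Noetherian local rings have isomorphic `n`-th infinitesimal
neighborhoods `R/m_R^n ≅ S/m_S^n` for every `n ≥ 1`, then they are similar. -/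
theorem areSimilar_of_jets_isomorphic
    {R : Type u} {S : Type v} [CommRing R] [CommRing S]
    [IsNoetherianRing R] [IsNoetherianRing S] [IsLocalRing R] [IsLocalRing S]
    (h : ∀ n : ℕ, 1 ≤ n →
      Nonempty ((R ⧸ maximalIdeal R ^ n) ≃+* (S ⧸ maximalIdeal S ^ n))) :
    AreSimilar R S := by
  let N : ULift.{v} ℕ → ℕ := fun n ↦ n.down + 1
  have : (comap N atTop).NeBot := comap_neBot_iff_frequently.mpr <|
    (eventually_ge_atTop 1).frequently.mono fun k hk ↦ ⟨⟨k - 1⟩, Nat.sub_add_cancel hk⟩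
  let U := Ultrafilter.of (comap N atTop)
  have hN : Tendsto N U atTop := tendsto_comap.mono_left (Ultrafilter.of_le _)
  let B : ULift.{v} ℕ → Type u := fun n ↦ R ⧸ maximalIdeal R ^ N n
  have hB : ∀ n, IsLocalRing (B n) := fun n ↦ by
    have : Nontrivial (R ⧸ maximalIdeal R ^ N n) := Ideal.Quotient.nontrivial_iff.mpr
      (ne_top_of_le_ne_top Ideal.IsPrime.ne_top' (Ideal.pow_le_self n.down.succ_ne_zero))
    exact .of_surjective' (Ideal.Quotient.mk _) Ideal.Quotient.mk_surjective
  have e (n) := (h (N n) (by simp [N])).some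
  have hR := isCataproduct_mk_infinitesimalIdeal U hN B (fun n ↦ Ideal.Quotient.mk _)
    (fun n ↦ Ideal.Quotient.mk_surjective) (fun n ↦ Ideal.mk_ker.le)
  have hS := isCataproduct_mk_infinitesimalIdeal U hN B
    (fun n ↦ (e n).symm.toRingHom.comp (Ideal.Quotient.mk _))
    (fun n ↦ (e n).symm.surjective.comp Ideal.Quotient.mk_surjective)
    (fun n x hx ↦ by simpa [RingHom.mem_ker, Ideal.Quotient.eq_zero_iff_mem] using hx)
  have := hR.isLocalRing
  exact ⟨_, inferInstance, hR.isNoetherianRing hN, this, _, _, hR.isLocalHom, hS.isLocalHom,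
    hR.isScalarExtension hN, hS.isScalarExtension hN⟩
end

section
/- Every Noetherian local ring R with residue field κ has cardinality at most (max(ℵ₀, |κ|))^{ℵ₀}; in particular, the cardinality of a Noetherian local ring is bounded in terms of the cardinality of its residue field. -/
open IsLocalRing Cardinal

/-- If a subring contains generators of an ideal `I` and meets every class modulo `I`, then it
meets every class modulo every power of `I`. -/
theorem Subring.exists_sub_mem_pow {R : Type*} [CommRing R] (S : Subring R) {I : Ideal R}
    {G : Set R} (hG : Ideal.span G = I) (hGS : G ⊆ S) (hS : ∀ r, ∃ s ∈ S, r - s ∈ I)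
    (n : ℕ) (r : R) : ∃ s ∈ S, r - s ∈ I ^ n := by
  induction n generalizing r with
  | zero => exact ⟨0, S.zero_mem, by simp⟩
  | succ n ih =>
    have key : ∀ x ∈ Ideal.span G, ∃ s ∈ S, x - s ∈ I ^ (n + 1) := by
      intro x hx
      induction hx using Submodule.span_induction with
      | mem x hx => exact ⟨x, hGS hx, by simp⟩
      | zero => exact ⟨0, S.zero_mem, by simp⟩
      | add x y _ _ hx hy =>
        obtain ⟨s, hs, hxs⟩ := hx
        obtain ⟨t, ht, hyt⟩ := hy
        refine ⟨s + t, S.add_mem hs ht, ?_⟩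
        rw [add_sub_add_comm]
        exact add_mem hxs hyt
      | smul a x hx ih' =>
        obtain ⟨s, hs, hxs⟩ := ih'
        obtain ⟨t, ht, hat⟩ := ih a
        refine ⟨t * s, S.mul_mem ht hs, ?_⟩
        have h : a • x - t * s = (a - t) * x + t * (x - s) := by
          rw [smul_eq_mul]; ring
        rw [h, pow_succ]
        refine add_mem (Ideal.mul_mem_mul hat (hG ▸ hx)) (Ideal.mul_mem_left _ _ ?_)
        rwa [← pow_succ]
    obtain ⟨s, hs, hrs⟩ := hS r
    obtain ⟨t, ht, hst⟩ := key (r - s) (hG ▸ hrs)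
    exact ⟨s + t, S.add_mem hs ht, by rwa [← sub_sub]⟩

/-- every Noetherian local ring `R` with residue field `κ` has cardinality at most
`(max(ℵ₀, #κ))^ℵ₀`; in particular, the cardinality of a Noetherian local ring is bounded in
terms of the cardinality of its residue field. -/
theorem card_le_of_noetherian_local
    (R : Type*) [CommRing R] [IsNoetherianRing R] [IsLocalRing R] :
    #R ≤ (max ℵ₀ #(ResidueField R)) ^ ℵ₀ := by
  obtain ⟨G, hG⟩ := (isNoetherianRing_iff_ideal_fg R).1 ‹_› (maximalIdeal R)
  let σ := Function.surjInv (residue_surjective (R := R))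
  let A : Set R := Set.range σ ∪ G
  let S := (Algebra.adjoin ℤ A).toSubring
  have hAS : A ⊆ S := Algebra.subset_adjoin
  have hS : ∀ n r, ∃ s ∈ S, r - s ∈ maximalIdeal R ^ n :=
    S.exists_sub_mem_pow hG (Set.subset_union_right.trans hAS) fun r ↦
      ⟨σ (residue R r), hAS (.inl ⟨_, rfl⟩), by
        rw [← residue_eq_zero_iff, map_sub, Function.surjInv_eq residue_surjective, sub_self]⟩
  choose f hfS hf using hS
  have hinj : Function.Injective fun r (n : ℕ) ↦ (⟨f n r, hfS n r⟩ : S) := by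
    intro r r' h
    rw [← sub_eq_zero, ← Ideal.mem_bot,
      ← Ideal.iInf_pow_eq_bot_of_isLocalRing _ (maximalIdeal.isMaximal R).ne_top]
    refine Ideal.mem_iInf.2 fun n ↦ ?_
    have hn : f n r = f n r' := congrArg Subtype.val (congrFun h n)
    simpa [hn] using sub_mem (hf n r) (hf n r')
  have hA : #A ≤ max ℵ₀ #(ResidueField R) := by
    refine (mk_union_le _ _).trans (add_le_of_le (le_max_left _ _) ?_ ?_)
    · exact mk_range_le.trans (le_max_right _ _)
    · exact mk_le_aleph0.trans (le_max_left _ _)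
  have hcard : #S ≤ max ℵ₀ #(ResidueField R) := by
    have h := Algebra.lift_cardinalMk_adjoin_le ℤ A
    simp only [lift_uzero, mk_int, lift_aleph0] at h
    exact h.trans (max_le (max_le (le_max_left _ _) hA) (le_max_left _ _))
  calc #R ≤ #(ℕ → S) := mk_le_of_injective hinj
    _ = #S ^ ℵ₀ := by simp
    _ ≤ _ := power_le_power_right hcard
end

section
/- Let R → S be a scalar extension of Noetherian local rings, with residue fields κ = R/m_R and λ = S/m_S. Then for every n ≥ 0, the κ-vector space Tor_n^R(κ, κ) and the λ-vector space Tor_n^S(λ, λ) have the same finite dimension; that is, R and S have the same Betti numbers of their residue fields, hence the same residual Poincaré series. -/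
open IsLocalRing CategoryTheory

/-- `Tor_n^R(κ, κ)` for `κ` the residue field of the local ring `R`, as an `R`-module. -/
noncomputable def residueTor (R : Type*) [CommRing R] [IsLocalRing R] (n : ℕ) :
    ModuleCat R :=
  ((Tor (ModuleCat R) n).obj (ModuleCat.of R (ResidueField R))).obj
    (ModuleCat.of R (ResidueField R))

/-- If a module has length `k`, then it has a composition series of length `k`. -/
lemma hasLength_of_length_eq {R M : Type*} [Ring R] [AddCommGroup M] [Module R M] {k : ℕ}
    (h : Module.length R M = k) : HasLength R M k := by
  obtain ⟨s, h₀, h₁⟩ := isFiniteLength_iff_exists_compositionSeries.mp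
    (Module.length_ne_top_iff.mp (h ▸ ENat.natCast_ne_top k))
  exact ⟨s, h₀, h₁, by exact_mod_cast (Module.length_compositionSeries s h₀ h₁).trans h⟩

/-- A minimal resolution of the residue field of a local ring by finite free modules, given by
the matrices of its differentials. The module in degree `0` is the ring itself, and the augmentation
is the residue map. -/
structure MinimalResolution (R : Type*) [CommRing R] [IsLocalRing R] where
  /-- the ranks of the free modules -/
  rank : ℕ → ℕ
  /-- the matrices of the differentials -/
  mat : ∀ n, Matrix (Fin (rank n)) (Fin (rank (n + 1))) R
  exact : ∀ n, Function.Exact (mat (n + 1)).mulVecLin (mat n).mulVecLin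
  minimal : ∀ n i j, mat n i j ∈ maximalIdeal R
  rank_zero : rank 0 = 1
  mem_range : ∀ x : Fin (rank 0) → R, (∀ i, x i ∈ maximalIdeal R) →
    x ∈ LinearMap.range (mat 0).mulVecLin

/-- The homology of a complex with zero differentials. -/
noncomputable def homologyIsoOfDEqZero {C ι : Type*} [Category* C] [Abelian C]
    {c : ComplexShape ι} (K : HomologicalComplex C c) (h : ∀ i j, K.d i j = 0) (n : ι) :
    K.homology n ≅ K.X n :=
  (ShortComplex.HomologyData.ofZeros (K.sc n) (h _ _) (h _ _)).left.homologyIso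

lemma mulVec_apply_mem {R m n : Type*} [CommRing R] [Fintype n] {I : Ideal R}
    {A : Matrix m n R} (hA : ∀ i j, A i j ∈ I) (v : n → R) (i : m) : A.mulVec v i ∈ I :=
  I.sum_mem fun j _ ↦ I.mul_mem_right _ (hA i j)

lemma tmul_eq_zero_of_forall_mem {R ι : Type*} [CommRing R] [IsLocalRing R] [Fintype ι]
    (x : ResidueField R) {w : ι → R} (hw : ∀ i, w i ∈ maximalIdeal R) :
    x ⊗ₜ[R] w = 0 := by
  classical
  apply (TensorProduct.piScalarRight R R (ResidueField R) ι).injective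
  ext i
  simp [Algebra.smul_def, ResidueField.algebraMap_eq, (residue_eq_zero_iff _).mpr (hw i)]

lemma length_residueField_tensor_pi (R : Type*) [CommRing R] [IsLocalRing R] (b : ℕ) :
    Module.length R (TensorProduct R (ResidueField R) (Fin b → R)) = b := by
  have : IsSimpleModule R (ResidueField R) :=
    isSimpleModule_iff_quot_maximal.mpr
      ⟨maximalIdeal R, inferInstance, ⟨LinearEquiv.refl R (R ⧸ maximalIdeal R)⟩⟩
  rw [(TensorProduct.piScalarRight R R (ResidueField R) (Fin b)).length_eq, Module.length_pi]
  simp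

namespace MinimalResolution

universe u

variable {R : Type u} [CommRing R] [IsLocalRing R] (P : MinimalResolution R)

/-- The underlying chain complex of a minimal resolution. -/
noncomputable def complex : ChainComplex (ModuleCat.{u} R) ℕ :=
  ChainComplex.of (fun n ↦ ModuleCat.of R (Fin (P.rank n) → R))
    (fun n ↦ ModuleCat.ofHom (P.mat n).mulVecLin)
    (fun n ↦ by
      rw [← ModuleCat.ofHom_comp, (P.exact n).linearMap_comp_eq_zero]
      rfl)

lemma complex_d (n : ℕ) :
    P.complex.d (n + 1) n = ModuleCat.ofHom (P.mat n).mulVecLin :=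
  ChainComplex.of_d (fun n ↦ ModuleCat.of R (Fin (P.rank n) → R))
    (fun n ↦ ModuleCat.ofHom (P.mat n).mulVecLin) n

/-- The augmentation of a minimal resolution. -/
noncomputable def augmentation : (Fin (P.rank 0) → R) →ₗ[R] ResidueField R :=
  Algebra.linearMap R (ResidueField R) ∘ₗ
    LinearMap.proj ⟨0, P.rank_zero.symm ▸ Nat.one_pos⟩

lemma augmentation_surjective : Function.Surjective P.augmentation := by
  intro y
  obtain ⟨r, rfl⟩ := residue_surjective y
  exact ⟨fun _ ↦ r, rfl⟩

lemma exact_augmentation : Function.Exact (P.mat 0).mulVecLin P.augmentation := by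
  intro x
  have hx : P.augmentation x = 0 ↔ ∀ i, x i ∈ maximalIdeal R := by
    have : Subsingleton (Fin (P.rank 0)) := by rw [P.rank_zero]; infer_instance
    change residue R (x _) = 0 ↔ _
    rw [residue_eq_zero_iff]
    exact ⟨fun h i ↦ Subsingleton.elim _ i ▸ h, fun h ↦ h _⟩
  rw [hx]
  refine ⟨P.mem_range x, ?_⟩
  rintro ⟨v, rfl⟩ i
  exact mulVec_apply_mem (P.minimal 0) v i

/-- A minimal resolution as a projective resolution in the category of modules. -/
noncomputable def toProjectiveResolution :
    ProjectiveResolution (ModuleCat.of R (ResidueField R)) where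
  complex := P.complex
  projective n := by
    change Projective (ModuleCat.of R (Fin (P.rank n) → R))
    infer_instance
  π := (ChainComplex.toSingle₀Equiv _ _).symm ⟨ModuleCat.ofHom P.augmentation, by
    rw [complex_d]
    exact ModuleCat.hom_ext P.exact_augmentation.linearMap_comp_eq_zero⟩
  quasiIso := ⟨fun n ↦ by
    cases n with
    | zero =>
      rw [ChainComplex.quasiIsoAt₀_iff, ShortComplex.quasiIso_iff_of_zeros']
      · refine (ShortComplex.exact_and_epi_g_iff_of_iso
          (S₂ := ShortComplex.mk (ModuleCat.ofHom (P.mat 0).mulVecLin)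
            (ModuleCat.ofHom P.augmentation)
            (ModuleCat.hom_ext P.exact_augmentation.linearMap_comp_eq_zero)) ?_).2 ⟨?_, ?_⟩
        · exact ShortComplex.isoMk (Iso.refl _) (Iso.refl _) (Iso.refl _)
            ((Category.id_comp _).trans ((P.complex_d 0).symm.trans (Category.comp_id _).symm))
            ((Category.id_comp _).trans
              ((ChainComplex.toSingle₀Equiv_symm_apply_f_zero (C := P.complex)
                (ModuleCat.ofHom P.augmentation) _).symm.trans
                (Category.comp_id _).symm))
        · rw [ShortComplex.ShortExact.moduleCat_exact_iff_function_exact]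
          exact P.exact_augmentation
        · exact (ModuleCat.epi_iff_surjective _).mpr P.augmentation_surjective
      all_goals rfl
    | succ n =>
      rw [quasiIsoAt_iff_exactAt' (hL := ChainComplex.exactAt_succ_single_obj ..),
        HomologicalComplex.exactAt_iff' _ (n + 2) (n + 1) n (by simp) (by simp),
        ShortComplex.ShortExact.moduleCat_exact_iff_function_exact]
      change Function.Exact (P.complex.d (n + 2) (n + 1)) (P.complex.d (n + 1) n)
      rw [complex_d, complex_d]
      exact P.exact n⟩

open MonoidalCategory in
lemma hasLength_residueTor (n : ℕ) : HasLength R (residueTor R n) (P.rank n) := by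
  let F := (tensoringLeft (ModuleCat.{u} R)).obj (ModuleCat.of R (ResidueField R))
  let K := (F.mapHomologicalComplex (ComplexShape.down ℕ)).obj P.complex
  have hK : ∀ i j, K.d i j = 0 := by
    intro i j
    by_cases hij : (ComplexShape.down ℕ).Rel i j
    · obtain rfl : j + 1 = i := hij
      change F.map (P.complex.d (j + 1) j) = 0
      rw [complex_d]
      refine ModuleCat.hom_ext (TensorProduct.ext' fun x v ↦ ?_)
      exact tmul_eq_zero_of_forall_mem x (mulVec_apply_mem (P.minimal j) v)
    · exact K.shape i j hij
  have e : residueTor R n ≅ F.obj (P.complex.X n) :=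
    P.toProjectiveResolution.isoLeftDerivedObj F n ≪≫ homologyIsoOfDEqZero K hK n
  apply hasLength_of_length_eq
  rw [e.toLinearEquiv.length_eq]
  exact length_residueField_tensor_pi R (P.rank n)

end MinimalResolution

section BaseChange

variable {R S : Type*} [CommRing R] [CommRing S] [Algebra R S]

lemma piScalarRight_comp_lTensor_mulVecLin {m n : Type*} [Fintype m] [DecidableEq m] [Fintype n]
    [DecidableEq n] (A : Matrix m n R) :
    ((A.map (algebraMap R S)).mulVecLin.restrictScalars R) ∘ₗ
        (TensorProduct.piScalarRight R R S n : TensorProduct R S (n → R) →ₗ[R] n → S) =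
      (TensorProduct.piScalarRight R R S m : TensorProduct R S (m → R) →ₗ[R] m → S) ∘ₗ
        A.mulVecLin.lTensor S := by
  refine TensorProduct.ext' fun s v ↦ funext fun i ↦ ?_
  simp [Matrix.mulVec, dotProduct, Algebra.smul_def, Finset.sum_mul, mul_assoc]

/-- Exactness of a pair of matrices is preserved by flat base change. -/
lemma exact_mulVecLin_map [Module.Flat R S] {l m n : Type*} [Fintype l] [Fintype m]
    [Fintype n] {A : Matrix l m R} {B : Matrix m n R}
    (h : Function.Exact B.mulVecLin A.mulVecLin) :
    Function.Exact (B.map (algebraMap R S)).mulVecLin (A.map (algebraMap R S)).mulVecLin := by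
  classical
  exact Function.Exact.of_ladder_linearEquiv_of_exact
    (g₁₂ := (B.map (algebraMap R S)).mulVecLin.restrictScalars R)
    (g₂₃ := (A.map (algebraMap R S)).mulVecLin.restrictScalars R)
    (piScalarRight_comp_lTensor_mulVecLin B) (piScalarRight_comp_lTensor_mulVecLin A)
    (Module.Flat.lTensor_exact S h)

/-- The base change of a minimal resolution along a flat unramified homomorphism. -/
def MinimalResolution.baseChange [IsLocalRing R] [IsLocalRing S] [Module.Flat R S]
    (h : (maximalIdeal R).map (algebraMap R S) = maximalIdeal S) (P : MinimalResolution R) :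
    MinimalResolution S where
  rank := P.rank
  mat n := (P.mat n).map (algebraMap R S)
  exact n := exact_mulVecLin_map (P.exact n)
  minimal n i j := h ▸ Ideal.mem_map_of_mem _ (P.minimal n i j)
  rank_zero := P.rank_zero
  mem_range x hx := by
    have : Subsingleton (Fin (P.rank 0)) := by rw [P.rank_zero]; infer_instance
    have key : maximalIdeal S ≤ (LinearMap.range ((P.mat 0).map (algebraMap R S)).mulVecLin).comap
        (LinearMap.toSpanSingleton S (Fin (P.rank 0) → S) 1) := by
      rw [← h, Ideal.map]
      refine Submodule.span_le.mpr ?_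
      rintro _ ⟨a, ha, rfl⟩
      obtain ⟨v, hv⟩ := P.mem_range (fun _ ↦ a) fun _ ↦ ha
      refine ⟨algebraMap R S ∘ v, funext fun i ↦ ?_⟩
      have := congrFun hv i
      rw [Matrix.mulVecLin_apply] at this
      simp [← RingHom.map_mulVec, this]
    have hx₀ : x = x ⟨0, P.rank_zero.symm ▸ Nat.one_pos⟩ • (1 : Fin (P.rank 0) → S) := by
      ext i
      simp [Subsingleton.elim i ⟨0, P.rank_zero.symm ▸ Nat.one_pos⟩]
    rw [hx₀]
    exact key (hx _)

end BaseChange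

section Existence

variable {R : Type*} [CommRing R] [IsLocalRing R]

/-- A finite module over a local ring has a finite generating family all of whose relations have
coefficients in the maximal ideal. -/
lemma exists_minimal_generators (M : Type*) [AddCommGroup M] [Module R M] [Module.Finite R M] :
    ∃ (k : ℕ) (v : Fin k → M), Submodule.span R (Set.range v) = ⊤ ∧
      ∀ c : Fin k → R, ∑ i, c i • v i = 0 → ∀ i, c i ∈ maximalIdeal R := by
  let b := Module.finBasis (ResidueField R) (TensorProduct R (ResidueField R) M)
  obtain ⟨v, hv⟩ := (TensorProduct.mk_surjective R M (ResidueField R)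
    Ideal.Quotient.mk_surjective).comp_left b
  have hv' (i) : 1 ⊗ₜ[R] v i = b i := congrFun hv i
  refine ⟨_, v, span_eq_top_of_tmul_eq_basis v b hv', fun c hc i ↦ ?_⟩
  rw [← residue_eq_zero_iff]
  refine Fintype.linearIndependent_iff.mp b.linearIndependent (fun j ↦ residue R (c j)) ?_ i
  have := congrArg (TensorProduct.mk R (ResidueField R) M 1) hc
  simp only [map_sum, map_smul, map_zero, TensorProduct.mk_apply, hv'] at this
  rw [← this]
  refine Finset.sum_congr rfl fun j _ ↦ ?_
  rw [← ResidueField.algebraMap_eq, algebraMap_smul]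

variable [IsNoetherianRing R]

lemma exists_minimal_matrix {m : ℕ} (N : Submodule R (Fin m → R)) :
    ∃ (k : ℕ) (B : Matrix (Fin m) (Fin k) R), LinearMap.range B.mulVecLin = N ∧
      ∀ c, B.mulVec c = 0 → ∀ i, c i ∈ maximalIdeal R := by
  obtain ⟨k, v, hv, hc⟩ := exists_minimal_generators (R := R) N
  refine ⟨k, Matrix.of fun i j ↦ (v j : Fin m → R) i, ?_, fun c h ↦ hc c ?_⟩
  · have := congrArg (Submodule.map N.subtype) hv
    rw [Submodule.map_span, Submodule.map_top, Submodule.range_subtype, ← Set.range_comp] at this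
    rw [Matrix.range_mulVecLin]
    exact this
  · ext i
    simpa [Matrix.mulVec, dotProduct, mul_comm] using congrFun h i

/-- A matrix over `R` together with its dimensions. -/
abbrev SizedMatrix (R : Type*) := Σ (m n : ℕ), Matrix (Fin m) (Fin n) R

variable (R) in
/-- The successive matrices in a minimal resolution of the residue field. -/
noncomputable def minimalMatrix : ℕ → SizedMatrix R
  | 0 =>
    let h := exists_minimal_matrix (Submodule.pi Set.univ fun _ : Fin 1 ↦ maximalIdeal R)
    ⟨1, h.choose, h.choose_spec.choose⟩
  | n + 1 =>
    let h := exists_minimal_matrix (LinearMap.ker (minimalMatrix n).2.2.mulVecLin)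
    ⟨(minimalMatrix n).2.1, h.choose, h.choose_spec.choose⟩

lemma range_minimalMatrix_zero :
    LinearMap.range (minimalMatrix R 0).2.2.mulVecLin =
      Submodule.pi Set.univ fun _ ↦ maximalIdeal R :=
  (exists_minimal_matrix _).choose_spec.choose_spec.1

lemma range_minimalMatrix_succ (n : ℕ) :
    LinearMap.range (minimalMatrix R (n + 1)).2.2.mulVecLin =
      LinearMap.ker (minimalMatrix R n).2.2.mulVecLin :=
  (exists_minimal_matrix _).choose_spec.choose_spec.1

lemma mem_of_minimalMatrix_mulVec_eq_zero (n : ℕ) (c : Fin (minimalMatrix R n).2.1 → R)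
    (hc : (minimalMatrix R n).2.2.mulVec c = 0) (i) : c i ∈ maximalIdeal R := by
  cases n with
  | zero => exact (exists_minimal_matrix _).choose_spec.choose_spec.2 c hc i
  | succ n => exact (exists_minimal_matrix _).choose_spec.choose_spec.2 c hc i

lemma mulVec_minimalMatrix_mem (n : ℕ) (c : Fin (minimalMatrix R n).2.1 → R) (i) :
    (minimalMatrix R n).2.2.mulVec c i ∈ maximalIdeal R := by
  have hc := LinearMap.mem_range_self (minimalMatrix R n).2.2.mulVecLin c
  cases n with
  | zero =>
    rw [range_minimalMatrix_zero] at hc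
    exact hc i trivial
  | succ n =>
    rw [range_minimalMatrix_succ] at hc
    exact mem_of_minimalMatrix_mulVec_eq_zero n _ hc i

lemma minimalMatrix_apply_mem (n : ℕ) (i) (j) :
    (minimalMatrix R n).2.2 i j ∈ maximalIdeal R := by
  have := mulVec_minimalMatrix_mem n (Pi.single j 1) i
  rwa [Matrix.mulVec_single_one] at this

variable (R) in
/-- The residue field of a Noetherian local ring has a minimal resolution. -/
noncomputable def minimalResolution : MinimalResolution R where
  rank n := (minimalMatrix R n).1
  mat n := (minimalMatrix R n).2.2
  exact n := LinearMap.exact_iff.mpr (range_minimalMatrix_succ n).symm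
  minimal := minimalMatrix_apply_mem
  rank_zero := rfl
  mem_range _ hx := range_minimalMatrix_zero.ge fun i _ ↦ hx i

end Existence

/-- a scalar extension `R → S` of Noetherian local rings preserves the Betti
numbers of the residue field: for each `n`, `Tor_n^R(κ, κ)` and `Tor_n^S(λ, λ)` have the same
finite dimension (as vector spaces over `κ` resp. `λ`, i.e. the same finite length); hence `R`
and `S` have the same residual Poincaré series. -/
theorem betti_numbers_eq_of_isScalarExtension
    {R S : Type*} [CommRing R] [CommRing S]
    [IsNoetherianRing R] [IsNoetherianRing S] [IsLocalRing R] [IsLocalRing S]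
    (f : R →+* S) (hfloc : IsLocalHom f) (hf : IsScalarExtension f) :
    ∀ n : ℕ, ∃ k : ℕ, HasLength R (residueTor R n) k ∧ HasLength S (residueTor S n) k := by
  let := f.toAlgebra
  have : Module.FaithfullyFlat R S := hf.1
  let P := minimalResolution R
  exact fun n ↦ ⟨P.rank n, P.hasLength_residueTor n, (P.baseChange hf.2).hasLength_residueTor n⟩
end
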